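/- arXiv:1604.08709 — 11 statements merged into one kernel-verified Lean document; each statement's English description precedes it below -/
import Mathlib

section
/- For any set Σ ∪ {φ} of ELKv^r formulas: Σ semantically entails φ over FO Kripke models (i.e., every pointed FO Kripke model satisfying all of T(Σ)'s preimages Σ satisfies φ) if and only if T(Σ) semantically entails T(φ) over MLKv^r models. In particular, for every ELKv^r formula φ, φ is valid on all FO Kripke models iff T(φ) is valid on all MLKv^r models. -/
/-- A Kripke frame with binary relations `rel i` and ternary relations `relc i c`,
together with a valuation; an MLKv^r model is such a frame satisfying `IsMLKv`. -/
structure KFrame where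
  S : Type
  rel : ℕ → S → S → Prop
  relc : ℕ → ℕ → S → S → S → Prop
  val : S → ℕ → Prop

/-- The three frame conditions SYM, INCL and ATEUC of MLKv^r models. -/
def KFrame.IsMLKv (M : KFrame) : Prop :=
  (∀ i c s t u, M.relc i c s t u ↔ M.relc i c s u t) ∧
  (∀ i c s t u, M.relc i c s t u → M.rel i s t ∧ M.rel i s u) ∧
  (∀ i c s t u v, M.relc i c s t u → M.rel i s v → M.relc i c s t v ∨ M.relc i c s u v)

/-- The language MLKv^r with unary modalities `box i` (□_i) and `boxc i c` (□_i^c). -/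
inductive FormM : Type
  | top : FormM
  | atom : ℕ → FormM
  | neg : FormM → FormM
  | and : FormM → FormM → FormM
  | box : ℕ → FormM → FormM
  | boxc : ℕ → ℕ → FormM → FormM

namespace FormM
def imp (φ ψ : FormM) : FormM := neg (and φ (neg ψ))
def or (φ ψ : FormM) : FormM := neg (and (neg φ) (neg ψ))
def iff (φ ψ : FormM) : FormM := and (imp φ ψ) (imp ψ φ)
def bot : FormM := neg top
def dia (i : ℕ) (φ : FormM) : FormM := neg (box i (neg φ))
def diac (i c : ℕ) (φ : FormM) : FormM := neg (boxc i c (neg φ))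
end FormM

/-- Satisfaction for MLKv^r formulas; `boxc i c φ` holds at `s` iff every pair of
`relc i c`-successors contains a `φ`-world (i.e. ¬∃ u v with `relc`, both ¬φ). -/
def satM (M : KFrame) : M.S → FormM → Prop
  | _, FormM.top => True
  | s, FormM.atom p => M.val s p
  | s, FormM.neg φ => ¬ satM M s φ
  | s, FormM.and φ ψ => satM M s φ ∧ satM M s ψ
  | s, FormM.box i φ => ∀ t, M.rel i s t → satM M t φ
  | s, FormM.boxc i c φ => ∀ t u, M.relc i c s t u → satM M t φ ∨ satM M u φ

/-- The language ELKv^r with `K i` (knowing that) and `Kv i φ c` (conditionally knowing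
the value of `c` given `φ`). -/
inductive FormE : Type
  | top : FormE
  | atom : ℕ → FormE
  | neg : FormE → FormE
  | and : FormE → FormE → FormE
  | K : ℕ → FormE → FormE
  | Kv : ℕ → FormE → ℕ → FormE

/-- A first-order Kripke model: a Kripke model with a nonempty constant domain `D` and
an assignment `valC` of a value in `D` to each constant at each state. -/
structure FOModel where
  S : Type
  D : Type
  Dnonempty : Nonempty D
  rel : ℕ → S → S → Prop
  val : S → ℕ → Prop
  valC : ℕ → S → D

/-- Satisfaction for ELKv^r formulas over FO Kripke models. -/
def satE (M : FOModel) : M.S → FormE → Prop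
  | _, FormE.top => True
  | s, FormE.atom p => M.val s p
  | s, FormE.neg φ => ¬ satE M s φ
  | s, FormE.and φ ψ => satE M s φ ∧ satE M s ψ
  | s, FormE.K i φ => ∀ t, M.rel i s t → satE M t φ
  | s, FormE.Kv i φ c => ∀ t u, M.rel i s t → M.rel i s u →
      satE M t φ → satE M u φ → M.valC c t = M.valC c u

/-- The translation T from ELKv^r to MLKv^r: it commutes with ⊤, atoms, ¬, ∧,
sends `K i φ` to `□_i T(φ)` and `Kv i φ c` to `□_i^c ¬T(φ)`. -/
def T : FormE → FormM
  | .top => .top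
  | .atom p => .atom p
  | .neg φ => .neg (T φ)
  | .and φ ψ => .and (T φ) (T ψ)
  | .K i φ => .box i (T φ)
  | .Kv i φ c => .boxc i c (.neg (T φ))

/-- The MLKv^r model of an FO model: two successors are `relc i c`-related when they
disagree on the value of `c`. -/
def FOModel.toKFrame (M : FOModel) : KFrame where
  S := M.S
  rel := M.rel
  relc i c s t u := M.rel i s t ∧ M.rel i s u ∧ M.valC c t ≠ M.valC c u
  val := M.val

theorem FOModel.isMLKv_toKFrame (M : FOModel) : M.toKFrame.IsMLKv := by
  refine ⟨fun i c s t u => ?_, fun i c s t u h => ⟨h.1, h.2.1⟩, fun i c s t u v h hv => ?_⟩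
  · exact ⟨fun h => ⟨h.2.1, h.1, h.2.2.symm⟩, fun h => ⟨h.2.1, h.1, h.2.2.symm⟩⟩
  · obtain ⟨ht, hu, hne⟩ := h
    by_cases htv : M.valC c t = M.valC c v
    · exact Or.inr ⟨hu, hv, fun huv => hne (htv.trans huv.symm)⟩
    · exact Or.inl ⟨ht, hv, htv⟩

theorem FOModel.satM_toKFrame (M : FOModel) (φ : FormE) (s : M.S) :
    satM M.toKFrame s (T φ) ↔ satE M s φ := by
  induction φ generalizing s with
  | top => exact Iff.rfl
  | atom p => exact Iff.rfl
  | neg φ ih => exact not_congr (ih s)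
  | and φ ψ ihφ ihψ => exact and_congr (ihφ s) (ihψ s)
  | K i φ ih => exact forall_congr' fun t => imp_congr_right fun _ => ih t
  | Kv i φ c ih =>
    refine forall_congr' fun t => forall_congr' fun u => ?_
    change (M.rel i s t ∧ M.rel i s u ∧ M.valC c t ≠ M.valC c u →
      ¬ satM M.toKFrame t (T φ) ∨ ¬ satM M.toKFrame u (T φ)) ↔ _
    rw [ih t, ih u]
    tauto

namespace KFrame

/-- A step of the unravelling: an agent, the state reached, and a bit that duplicates it. -/
abbrev Step (N : KFrame) : Type := ℕ × N.S × Bool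

/-- The state in which a path starting from `r` (latest step first) ends. -/
def endpoint (N : KFrame) (r : N.S) : List N.Step → N.S
  | [] => r
  | (_, t, _) :: _ => t

/-- The paths at which `c` has the same value as at a given path: the path itself, and
its siblings not separated from it by `relc`. -/
def sameValue (N : KFrame) (r : N.S) (c : ℕ) : List N.Step → Set (List N.Step)
  | [] => {[]}
  | (i, t, b) :: σ => {τ | τ = (i, t, b) :: σ ∨ ∃ t' b', τ = (i, t', b') :: σ ∧
      N.rel i (N.endpoint r σ) t' ∧ ¬ N.relc i c (N.endpoint r σ) t t'}

/-- The FO model on the tree of paths from `r`. Every state is duplicated, so that a state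
`relc`-related to itself yields two successors with distinct values. -/
def unravel (N : KFrame) (r : N.S) : FOModel where
  S := List N.Step
  D := Set (List N.Step)
  Dnonempty := ⟨∅⟩
  rel i σ τ := ∃ t b, τ = (i, t, b) :: σ ∧ N.rel i (N.endpoint r σ) t
  val σ := N.val (N.endpoint r σ)
  valC c := N.sameValue r c

variable {N : KFrame} {r : N.S} {i c : ℕ} {σ : List N.Step} {t u : N.S}

theorem sameValue_subset (hN : N.IsMLKv) (ht : N.rel i (N.endpoint r σ) t)
    (h : ¬ N.relc i c (N.endpoint r σ) t u) (b b' : Bool) :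
    N.sameValue r c ((i, t, b) :: σ) ⊆ N.sameValue r c ((i, u, b') :: σ) := by
  obtain ⟨symm, -, ateuc⟩ := hN
  have h' : ¬ N.relc i c (N.endpoint r σ) u t := fun hut => h ((symm _ _ _ _ _).1 hut)
  rintro τ (rfl | ⟨v, d, rfl, hv, htv⟩)
  · exact Or.inr ⟨t, b, rfl, ht, h'⟩
  · refine Or.inr ⟨v, d, rfl, hv, fun huv => ?_⟩
    rcases ateuc _ _ _ _ _ _ huv ht with hut | hvt
    · exact h' hut
    · exact htv ((symm _ _ _ _ _).1 hvt)

theorem sameValue_eq (hN : N.IsMLKv) (ht : N.rel i (N.endpoint r σ) t)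
    (hu : N.rel i (N.endpoint r σ) u) (h : ¬ N.relc i c (N.endpoint r σ) t u) (b b' : Bool) :
    N.sameValue r c ((i, t, b) :: σ) = N.sameValue r c ((i, u, b') :: σ) :=
  (sameValue_subset hN ht h b b').antisymm
    (sameValue_subset hN hu (fun hut => h ((hN.1 _ _ _ _ _).1 hut)) b' b)

theorem sameValue_ne (hN : N.IsMLKv) (h : N.relc i c (N.endpoint r σ) t u) :
    N.sameValue r c ((i, t, false) :: σ) ≠ N.sameValue r c ((i, u, true) :: σ) := by
  intro heq
  have hmem : (i, t, false) :: σ ∈ N.sameValue r c ((i, u, true) :: σ) :=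
    heq ▸ Or.inl rfl
  rcases hmem with hmem | ⟨t', b', hmem, -, hut⟩
  · simp at hmem
  · simp only [List.cons.injEq, Prod.mk.injEq] at hmem
    obtain ⟨⟨-, rfl, -⟩, -⟩ := hmem
    exact hut ((hN.1 _ _ _ _ _).1 h)

theorem satE_unravel (hN : N.IsMLKv) (φ : FormE) (σ : List N.Step) :
    satE (N.unravel r) σ φ ↔ satM N (N.endpoint r σ) (T φ) := by
  induction φ generalizing σ with
  | top => exact Iff.rfl
  | atom p => exact Iff.rfl
  | neg φ ih => exact not_congr (ih σ)
  | and φ ψ ihφ ihψ => exact and_congr (ihφ σ) (ihψ σ)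
  | K i φ ih =>
    constructor
    · intro h t ht
      exact (ih ((i, t, false) :: σ)).1 (h _ ⟨t, false, rfl, ht⟩)
    · rintro h _ ⟨t, b, rfl, ht⟩
      exact (ih _).2 (h t ht)
  | Kv i φ c ih =>
    constructor
    · intro h t u htu
      obtain ⟨ht, hu⟩ := hN.2.1 _ _ _ _ _ htu
      by_contra! hcon
      obtain ⟨hφt, hφu⟩ := hcon
      exact sameValue_ne hN htu (h _ _ ⟨t, false, rfl, ht⟩ ⟨u, true, rfl, hu⟩
        ((ih ((i, t, false) :: σ)).2 (not_not.1 hφt))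
        ((ih ((i, u, true) :: σ)).2 (not_not.1 hφu)))
    · rintro h _ _ ⟨t, b, rfl, ht⟩ ⟨u, b', rfl, hu⟩ hφt hφu
      refine sameValue_eq hN ht hu (fun htu => ?_) b b'
      rcases h t u htu with hn | hn
      · exact hn ((ih _).1 hφt)
      · exact hn ((ih _).1 hφu)

end KFrame

theorem entails_iff_entails_translation (Γ : Set FormE) (φ : FormE) :
    (∀ (M : FOModel) (s : M.S), (∀ ψ ∈ Γ, satE M s ψ) → satE M s φ) ↔
    (∀ (N : KFrame), N.IsMLKv → ∀ t : N.S,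
      (∀ ψ ∈ Γ, satM N t (T ψ)) → satM N t (T φ)) := by
  constructor
  · intro h N hN t hΓ
    exact (KFrame.satE_unravel hN φ []).1
      (h (N.unravel t) [] fun ψ hψ => (KFrame.satE_unravel hN ψ []).2 (hΓ ψ hψ))
  · intro h M s hΓ
    exact (M.satM_toKFrame φ s).1
      (h _ M.isMLKv_toKFrame s fun ψ hψ => (M.satM_toKFrame ψ s).2 (hΓ ψ hψ))

/-- For any set Γ ∪ {φ} of ELKv^r formulas, Γ ⊨ φ over FO Kripke models iff
T(Γ) ⊨ T(φ) over MLKv^r models; in particular, φ is valid on all FO Kripke models iff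
T(φ) is valid on all MLKv^r models. -/
theorem stmt0 :
    (∀ (Γ : Set FormE) (φ : FormE),
      (∀ (M : FOModel) (s : M.S), (∀ ψ ∈ Γ, satE M s ψ) → satE M s φ) ↔
      (∀ (N : KFrame), N.IsMLKv → ∀ t : N.S,
        (∀ ψ ∈ Γ, satM N t (T ψ)) → satM N t (T φ))) ∧
    (∀ φ : FormE,
      (∀ (M : FOModel) (s : M.S), satE M s φ) ↔
      (∀ (N : KFrame), N.IsMLKv → ∀ t : N.S, satM N t (T φ))) := by
  refine ⟨entails_iff_entails_translation, fun φ => ?_⟩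
  simpa using entails_iff_entails_translation ∅ φ
end

section
/- For every pointed MLKv^r model N,t there exists a pointed FO Kripke model M,s such that for every ELKv^r formula φ: M,s ⊨ φ iff N,t ⊩ T(φ). -/
/-- The FO Kripke model built from `N`: a state `(s, i, v, b)` is a copy of the world `v`, tagged
by a bit `b` and regarded as an `i`-successor of `s`. The value of `c` there is the class of
`i`-successors of `s` not separated from `v` by `relc i c s`; the bit separates the two copies
of `v` when `relc i c s v v`. -/
def KFrame.toFOModel (N : KFrame) : FOModel where
  S := N.S × ℕ × N.S × Bool
  D := Set N.S × Prop
  Dnonempty := ⟨(∅, True)⟩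
  rel i x y := y.1 = x.2.2.1 ∧ y.2.1 = i ∧ N.rel i x.2.2.1 y.2.2.1
  val x p := N.val x.2.2.1 p
  valC c := fun (s, i, v, b) =>
    ({w | N.rel i s w ∧ (w = v ∨ ¬ N.relc i c s v w)}, b = true ∧ N.relc i c s v v)

theorem KFrame.toFOModel_valC_eq {N : KFrame} (hN : N.IsMLKv) {i c : ℕ} {s v w : N.S}
    (hv : N.rel i s v) (hw : N.rel i s w) (h : ¬ N.relc i c s v w) (a b : Bool) :
    N.toFOModel.valC c (s, i, v, a) = N.toFOModel.valC c (s, i, w, b) := by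
  obtain ⟨hsym, -, hateuc⟩ := hN
  have hwv : ¬ N.relc i c s w v := fun k => h ((hsym ..).1 k)
  have hvv : ¬ N.relc i c s v v := fun k => h ((hateuc _ _ _ _ _ _ k hw).elim id id)
  have hww : ¬ N.relc i c s w w := fun k => hwv ((hateuc _ _ _ _ _ _ k hv).elim id id)
  refine Prod.ext (Set.ext fun x => and_congr_right fun _ => ?_) (by simp [toFOModel, hvv, hww])
  constructor
  · rintro (rfl | hx)
    · exact Or.inr hwv
    · exact Or.inr fun k => (hateuc _ _ _ _ _ _ k hv).elim hwv fun k' => hx ((hsym ..).1 k')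
  · rintro (rfl | hx)
    · exact Or.inr h
    · exact Or.inr fun k => (hateuc _ _ _ _ _ _ k hw).elim h fun k' => hx ((hsym ..).1 k')

theorem KFrame.toFOModel_valC_ne {N : KFrame} (hN : N.IsMLKv) {i c : ℕ} {s v w : N.S}
    (h : N.relc i c s v w) :
    N.toFOModel.valC c (s, i, v, true) ≠ N.toFOModel.valC c (s, i, w, false) := by
  intro heq
  have hset := Set.ext_iff.1 (congrArg Prod.fst heq) v
  have hbit := congrArg Prod.snd heq
  rcases (hset.1 ⟨(hN.2.1 _ _ _ _ _ h).1, Or.inl rfl⟩).2 with rfl | hwv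
  · simp [toFOModel, h] at hbit
  · exact hwv ((hN.1 ..).1 h)

theorem KFrame.satE_toFOModel {N : KFrame} (hN : N.IsMLKv) (φ : FormE) (x : N.toFOModel.S) :
    satE N.toFOModel x φ ↔ satM N x.2.2.1 (T φ) := by
  induction φ generalizing x with
  | top => exact Iff.rfl
  | atom p => exact Iff.rfl
  | neg φ ih => exact not_congr (ih x)
  | and φ ψ ihφ ihψ => exact and_congr (ihφ x) (ihψ x)
  | K i φ ih =>
    constructor
    · intro h v hv
      exact (ih (x.2.2.1, i, v, false)).1 (h _ ⟨rfl, rfl, hv⟩)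
    · intro h y hy
      exact (ih y).2 (h _ hy.2.2)
  | Kv i φ c ih =>
    constructor
    · intro h v w hvw
      obtain ⟨hv, hw⟩ := hN.2.1 _ _ _ _ _ hvw
      refine not_and_or.1 fun ⟨hφv, hφw⟩ => toFOModel_valC_ne hN hvw ?_
      exact h _ _ ⟨rfl, rfl, hv⟩ ⟨rfl, rfl, hw⟩ ((ih (x.2.2.1, i, v, true)).2 hφv)
        ((ih (x.2.2.1, i, w, false)).2 hφw)
    · rintro h ⟨_, _, v, a⟩ ⟨_, _, w, b⟩ ⟨rfl, rfl, hv⟩ ⟨rfl, hi, hw⟩ hφv hφw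
      cases hi
      refine toFOModel_valC_eq hN hv hw (fun hvw => ?_) a b
      exact (h v w hvw).elim (fun k => k ((ih _).1 hφv)) fun k => k ((ih _).1 hφw)

/-- for every pointed MLKv^r model N,t there is a pointed FO Kripke model
M,s agreeing with it on all ELKv^r formulas modulo the translation T. -/
theorem stmt2 :
    ∀ (N : KFrame), N.IsMLKv → ∀ t : N.S,
      ∃ (M : FOModel) (s : M.S), ∀ φ : FormE, satE M s φ ↔ satM N t (T φ) := by
  intro N hN t
  exact ⟨N.toFOModel, (t, 0, t, false), fun φ => KFrame.satE_toFOModel hN φ _⟩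
end

section
/- The canonical model of SMLKV^r is an MLKv^r model; that is, each canonical ternary relation R_i^c satisfies SYM (sR_i^c uv implies sR_i^c vu), INCL (sR_i^c uv implies s→_i u and s→_i v), and ATEUC (sR_i^c uv and s→_i t imply sR_i^c ut or sR_i^c tv). -/
/-- Uniform substitution of `χ` for the atom `p`. -/
def FormM.subst (p : ℕ) (χ : FormM) : FormM → FormM
  | .top => .top
  | .atom q => if q = p then χ else .atom q
  | .neg φ => .neg (FormM.subst p χ φ)
  | .and φ ψ => .and (FormM.subst p χ φ) (FormM.subst p χ ψ)
  | .box i φ => .box i (FormM.subst p χ φ)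
  | .boxc i c φ => .boxc i c (FormM.subst p χ φ)

/-- `ReplM ψ χ φ φ'`: `φ'` is obtained from `φ` by replacing some occurrences of `ψ` by `χ`. -/
inductive ReplM (ψ χ : FormM) : FormM → FormM → Prop
  | base : ReplM ψ χ ψ χ
  | refl (φ : FormM) : ReplM ψ χ φ φ
  | neg {φ φ'} : ReplM ψ χ φ φ' → ReplM ψ χ (.neg φ) (.neg φ')
  | and {φ₁ φ₁' φ₂ φ₂'} : ReplM ψ χ φ₁ φ₁' → ReplM ψ χ φ₂ φ₂' →
      ReplM ψ χ (.and φ₁ φ₂) (.and φ₁' φ₂')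
  | box (i) {φ φ'} : ReplM ψ χ φ φ' → ReplM ψ χ (.box i φ) (.box i φ')
  | boxc (i c) {φ φ'} : ReplM ψ χ φ φ' → ReplM ψ χ (.boxc i c φ) (.boxc i c φ')

/-- `φ` is an instance of a propositional tautology: every Boolean valuation of formulas
respecting ⊤, ¬ and ∧ makes it true. -/
def TautM (φ : FormM) : Prop :=
  ∀ v : FormM → Bool, v .top = true → (∀ ψ, v (.neg ψ) = !v ψ) →
    (∀ ψ χ, v (.and ψ χ) = (v ψ && v χ)) → v φ = true

/-- The proof system SMLKV^r: TAUT, DISTK, DISTKv^r, Kv^r∨, with rules MP,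
necessitation for □_i and □_i^c, uniform substitution, and replacement of equivalents. -/
inductive ProvM : FormM → Prop
  | taut {φ} : TautM φ → ProvM φ
  | distK (i : ℕ) (φ ψ : FormM) :
      ProvM (.imp (.box i (.imp φ ψ)) (.imp (.box i φ) (.box i ψ)))
  | distKv (i c : ℕ) (φ ψ : FormM) :
      ProvM (.imp (.box i (.imp φ ψ)) (.imp (.boxc i c φ) (.boxc i c ψ)))
  | kvOr (i c : ℕ) (φ ψ : FormM) :
      ProvM (.imp (.and (.dia i (.and φ ψ)) (.diac i c (.or φ ψ)))
        (.or (.diac i c φ) (.diac i c ψ)))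
  | mp {φ ψ} : ProvM (.imp φ ψ) → ProvM φ → ProvM ψ
  | necK (i : ℕ) {φ} : ProvM φ → ProvM (.box i φ)
  | necKv (i c : ℕ) {φ} : ProvM φ → ProvM (.boxc i c φ)
  | subst (p : ℕ) (χ : FormM) {φ} : ProvM φ → ProvM (FormM.subst p χ φ)
  | re {ψ χ φ φ'} : ProvM (.iff ψ χ) → ReplM ψ χ φ φ' → ProvM (.iff φ φ')

/-- Conjunction of a finite list of formulas. -/
def conjM (L : List FormM) : FormM := L.foldr FormM.and FormM.top

/-- `φ` is derivable from `Γ` in SMLKV^r. -/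
def ProvFromM (Γ : Set FormM) (φ : FormM) : Prop :=
  ∃ L : List FormM, (∀ ψ ∈ L, ψ ∈ Γ) ∧ ProvM (.imp (conjM L) φ)

/-- `Γ` is SMLKV^r-consistent. -/
def ConsistentM (Γ : Set FormM) : Prop := ¬ ProvFromM Γ .bot

/-- `s` is a maximal SMLKV^r-consistent set. -/
def MCSM (s : Set FormM) : Prop :=
  ConsistentM s ∧ ∀ φ ∉ s, ¬ ConsistentM (insert φ s)

/-- Canonical binary relation: `s →_i t` iff `{φ : □_i φ ∈ s} ⊆ t`. -/
def canRel (i : ℕ) (s t : Set FormM) : Prop := ∀ φ, FormM.box i φ ∈ s → φ ∈ t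

/-- Canonical ternary relation: `s R_i^c t u` iff `{φ : □_i φ ∈ s} ⊆ t ∩ u` and
`{ψ : □_i^c ψ ∈ s} ⊆ t ∪ u`. -/
def canRelc (i c : ℕ) (s t u : Set FormM) : Prop :=
  (∀ φ, FormM.box i φ ∈ s → φ ∈ t ∧ φ ∈ u) ∧
  (∀ ψ, FormM.boxc i c ψ ∈ s → ψ ∈ t ∨ ψ ∈ u)

/-- The canonical model of SMLKV^r. -/
def canModelM : KFrame where
  S := {s : Set FormM // MCSM s}
  rel := fun i s t => canRel i s.val t.val
  relc := fun i c s t u => canRelc i c s.val t.val u.val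
  val := fun s p => FormM.atom p ∈ s.val

/-- Boolean valuations of formulas that respect ⊤, ¬ and ∧. -/
structure BoolValM (v : FormM → Bool) : Prop where
  top : v .top = true
  neg : ∀ ψ, v (.neg ψ) = !v ψ
  and : ∀ ψ χ, v (.and ψ χ) = (v ψ && v χ)

theorem tautM_of_boolValM {φ : FormM} (h : ∀ v, BoolValM v → v φ = true) : TautM φ :=
  fun v h₁ h₂ h₃ => h v ⟨h₁, h₂, h₃⟩

namespace BoolValM
variable {v : FormM → Bool}

theorem imp (hv : BoolValM v) (φ ψ : FormM) : v (.imp φ ψ) = (!v φ || v ψ) := by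
  simp [FormM.imp, hv.neg, hv.and]

theorem bot (hv : BoolValM v) : v .bot = false := by
  simp [FormM.bot, hv.neg, hv.top]

theorem conjM_eq_true (hv : BoolValM v) (L : List FormM) : v (conjM L) = true ↔ ∀ ψ ∈ L, v ψ = true := by
  induction L with
  | nil => simp [conjM, hv.top]
  | cons a L ih =>
    have : conjM (a :: L) = .and a (conjM L) := rfl
    simp [this, hv.and, ih]

end BoolValM

namespace MCSM
variable {s : Set FormM}

/-- A maximal consistent set is closed under derivability. -/
theorem mem_of_prov (hs : MCSM s) {φ : FormM} (L : List FormM) (hL : ∀ ψ ∈ L, ψ ∈ s)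
    (h : ProvM (.imp (conjM L) φ)) : φ ∈ s := by
  classical
  by_contra hφ
  obtain ⟨K, hK, hK'⟩ := not_not.mp (hs.2 φ hφ)
  refine hs.1 ⟨L ++ K.filter (· ≠ φ), ?_, ProvM.mp (ProvM.mp (ProvM.taut ?_) h) hK'⟩
  · intro ψ hψ
    rcases List.mem_append.mp hψ with hψ | hψ
    · exact hL ψ hψ
    · simp only [List.mem_filter, decide_eq_true_eq] at hψ
      exact (hK ψ hψ.1).resolve_left hψ.2
  · refine tautM_of_boolValM fun v hv => ?_
    have key : v (conjM (L ++ K.filter (· ≠ φ))) = true → v φ = true →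
        v (conjM K) = true := by
      simp only [hv.conjM_eq_true]
      intro h hφ ψ hψ
      by_cases he : ψ = φ
      · exact he ▸ hφ
      · exact h ψ (by simp [hψ, he])
    have key' : v (conjM (L ++ K.filter (· ≠ φ))) = true → v (conjM L) = true := by
      simp only [hv.conjM_eq_true]
      exact fun h ψ hψ => h ψ (List.mem_append_left _ hψ)
    simp only [hv.imp, hv.bot]
    grind

theorem mem_of_provM (hs : MCSM s) {φ : FormM} (h : ProvM φ) : φ ∈ s :=
  hs.mem_of_prov [] (by simp) <| ProvM.mp (ProvM.taut <| tautM_of_boolValM fun v hv => by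
    simp only [hv.imp]; grind) h

/-- A maximal consistent set is closed under tautological consequence. -/
theorem mem_of_entails (hs : MCSM s) {φ : FormM} (L : List FormM) (hL : ∀ ψ ∈ L, ψ ∈ s)
    (h : ∀ v, BoolValM v → (∀ ψ ∈ L, v ψ = true) → v φ = true) : φ ∈ s :=
  hs.mem_of_prov L hL <| ProvM.taut <| tautM_of_boolValM fun v hv => by
    have := h v hv
    rw [← hv.conjM_eq_true] at this
    rw [hv.imp]
    grind

theorem neg_mem_iff (hs : MCSM s) {φ : FormM} : .neg φ ∈ s ↔ φ ∉ s := by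
  classical
  constructor
  · refine fun hn hφ => hs.1 ⟨[φ, .neg φ], by simp [hn, hφ], ProvM.taut ?_⟩
    refine tautM_of_boolValM fun v hv => ?_
    simp [conjM, hv.imp, hv.and, hv.neg, hv.top, hv.bot]
  · intro hφ
    obtain ⟨K, hK, hK'⟩ := not_not.mp (hs.2 φ hφ)
    refine hs.mem_of_entails (.imp (conjM K) .bot :: K.filter (· ≠ φ)) ?_ ?_
    · intro ψ hψ
      rcases List.mem_cons.mp hψ with rfl | hψ
      · exact hs.mem_of_provM hK'
      · simp only [List.mem_filter, decide_eq_true_eq] at hψ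
        exact (hK ψ hψ.1).resolve_left hψ.2
    · intro v hv h
      have hb := h _ List.mem_cons_self
      rw [hv.imp, hv.bot, Bool.or_false, Bool.not_eq_true', ← Bool.not_eq_true,
        hv.conjM_eq_true] at hb
      rw [hv.neg, Bool.not_eq_true', ← Bool.not_eq_true]
      refine fun hφ => hb fun ψ hψ => ?_
      by_cases he : ψ = φ
      · exact he ▸ hφ
      · exact h ψ (by simp [hψ, he])

theorem and_mem_iff (hs : MCSM s) {φ ψ : FormM} : .and φ ψ ∈ s ↔ φ ∈ s ∧ ψ ∈ s := by
  refine ⟨fun h => ⟨?_, ?_⟩, fun h => ?_⟩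
  · exact hs.mem_of_entails [.and φ ψ] (by simp [h]) fun v hv => by simp +contextual [hv.and]
  · exact hs.mem_of_entails [.and φ ψ] (by simp [h]) fun v hv => by simp [hv.and]
  · exact hs.mem_of_entails [φ, ψ] (by simp [h]) fun v hv => by simp +contextual [hv.and]

theorem imp_mem_iff (hs : MCSM s) {φ ψ : FormM} : .imp φ ψ ∈ s ↔ (φ ∈ s → ψ ∈ s) := by
  simp [FormM.imp, hs.neg_mem_iff, hs.and_mem_iff]

theorem or_mem_iff (hs : MCSM s) {φ ψ : FormM} : .or φ ψ ∈ s ↔ φ ∈ s ∨ ψ ∈ s := by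
  simp only [FormM.or, hs.neg_mem_iff, hs.and_mem_iff]
  tauto

theorem dia_mem_iff (hs : MCSM s) {i : ℕ} {φ : FormM} : .dia i φ ∈ s ↔ .box i (.neg φ) ∉ s :=
  hs.neg_mem_iff

theorem diac_mem_iff (hs : MCSM s) {i c : ℕ} {φ : FormM} : .diac i c φ ∈ s ↔ .boxc i c (.neg φ) ∉ s :=
  hs.neg_mem_iff

theorem boxc_mem_of_provM (hs : MCSM s) {i c : ℕ} {φ ψ : FormM} (h : ProvM (.imp φ ψ))
    (hφ : .boxc i c φ ∈ s) : .boxc i c ψ ∈ s :=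
  hs.imp_mem_iff.mp (hs.imp_mem_iff.mp (hs.mem_of_provM (.distKv i c φ ψ))
    (hs.mem_of_provM (.necK i h))) hφ

end MCSM

theorem provM_imp_neg_neg (φ : FormM) : ProvM (.imp φ (.neg (.neg φ))) :=
  .taut <| tautM_of_boolValM fun v hv => by simp [hv.imp, hv.neg]

theorem canRelc_symm {i c : ℕ} {s t u : Set FormM} (h : canRelc i c s t u) :
    canRelc i c s u t :=
  ⟨fun φ hφ => (h.1 φ hφ).symm, fun ψ hψ => (h.2 ψ hψ).symm⟩

theorem canRelc_anti_euclidean {i c : ℕ} {s t u v : Set FormM} (hs : MCSM s) (ht : MCSM t)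
    (hu : MCSM u) (hv : MCSM v) (h : canRelc i c s t u) (hsv : canRel i s v) :
    canRelc i c s t v ∨ canRelc i c s u v := by
  by_contra! hcon
  have ex {w : Set FormM} (hw : canRel i s w) (hn : ¬ canRelc i c s w v) :
      ∃ φ, .boxc i c φ ∈ s ∧ φ ∉ w ∧ φ ∉ v := by
    by_contra! hall
    refine hn ⟨fun φ hφ => ⟨hw φ hφ, hsv φ hφ⟩, fun ψ hψ => ?_⟩
    by_contra! hψ'
    exact hψ'.2 (hall ψ hψ hψ'.1)
  obtain ⟨φ, hφ, hφt, hφv⟩ := ex (fun φ hφ => (h.1 φ hφ).1) hcon.1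
  obtain ⟨ψ, hψ, hψu, hψv⟩ := ex (fun φ hφ => (h.1 φ hφ).2) hcon.2
  have hdia : .dia i (.and (.neg φ) (.neg ψ)) ∈ s := by
    rw [hs.dia_mem_iff]
    intro hb
    have := hsv _ hb
    rw [hv.neg_mem_iff, hv.and_mem_iff, hv.neg_mem_iff, hv.neg_mem_iff] at this
    exact this ⟨hφv, hψv⟩
  have hboxc : .boxc i c (.neg (.or (.neg φ) (.neg ψ))) ∈ s := by
    by_contra hb
    have hor := hs.imp_mem_iff.mp (hs.mem_of_provM (.kvOr i c (.neg φ) (.neg ψ)))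
      (hs.and_mem_iff.mpr ⟨hdia, hs.diac_mem_iff.mpr hb⟩)
    rw [hs.or_mem_iff, hs.diac_mem_iff, hs.diac_mem_iff] at hor
    rcases hor with hor | hor
    · exact hor (hs.boxc_mem_of_provM (provM_imp_neg_neg φ) hφ)
    · exact hor (hs.boxc_mem_of_provM (provM_imp_neg_neg ψ) hψ)
  rcases h.2 _ hboxc with hm | hm
  · rw [ht.neg_mem_iff, ht.or_mem_iff, ht.neg_mem_iff] at hm
    exact hm (.inl hφt)
  · rw [hu.neg_mem_iff, hu.or_mem_iff, hu.neg_mem_iff] at hm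
    exact hm (.inr (hu.neg_mem_iff.mpr hψu))

/-- the canonical model of SMLKV^r is an MLKv^r model, i.e., its canonical
ternary relations satisfy SYM, INCL and ATEUC. -/
theorem stmt3 : canModelM.IsMLKv := by
  refine ⟨fun i c s t u => ⟨canRelc_symm, canRelc_symm⟩, fun i c s t u h => ?_,
    fun i c s t u v h hsv => ?_⟩
  · exact ⟨fun φ hφ => (h.1 φ hφ).1, fun φ hφ => (h.1 φ hφ).2⟩
  · exact canRelc_anti_euclidean s.2 t.2 u.2 v.2 h hsv
end

section
/- For any finitely many MLKv^r formulas ψ1, …, ψn, the formula □_i^c ψ1 ∧ ⋯ ∧ □_i^c ψn ∧ ◇_i(¬ψ1 ∧ ⋯ ∧ ¬ψn) → □_i^c(ψ1 ∧ ⋯ ∧ ψn) is a theorem of SMLKV^r. -/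
theorem TautM.imp_of_valuation {φ ψ : FormM}
    (h : ∀ v : FormM → Bool, v .top = true → (∀ θ, v (.neg θ) = !v θ) →
      (∀ θ χ, v (.and θ χ) = (v θ && v χ)) → v φ = true → v ψ = true) :
    TautM (.imp φ ψ) := by
  intro v ht hn ha
  have := h v ht hn ha
  simp only [FormM.imp, hn, ha]
  grind

theorem ProvM.imp_trans {φ ψ χ : FormM} (h₁ : ProvM (.imp φ ψ)) (h₂ : ProvM (.imp ψ χ)) :
    ProvM (.imp φ χ) := by
  refine .mp (.mp (.taut ?_) h₁) h₂
  intro v ht hn ha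
  simp only [FormM.imp, hn, ha]
  grind

theorem ProvM.imp_and {φ ψ χ : FormM} (h₁ : ProvM (.imp φ ψ)) (h₂ : ProvM (.imp φ χ)) :
    ProvM (.imp φ (.and ψ χ)) := by
  refine .mp (.mp (.taut ?_) h₁) h₂
  intro v ht hn ha
  simp only [FormM.imp, hn, ha]
  grind

theorem ProvM.and_left (φ ψ : FormM) : ProvM (.imp (.and φ ψ) φ) :=
  .taut <| .imp_of_valuation fun v _ _ ha => by grind

theorem ProvM.and_right (φ ψ : FormM) : ProvM (.imp (.and φ ψ) ψ) :=
  .taut <| .imp_of_valuation fun v _ _ ha => by grind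

theorem ProvM.neg_imp_neg {φ ψ : FormM} (h : ProvM (.imp φ ψ)) :
    ProvM (.imp (.neg ψ) (.neg φ)) := by
  refine .mp (.taut ?_) h
  intro v ht hn ha
  simp only [FormM.imp, hn, ha]
  grind

theorem ProvM.box_mono (i : ℕ) {φ ψ : FormM} (h : ProvM (.imp φ ψ)) :
    ProvM (.imp (.box i φ) (.box i ψ)) :=
  .mp (.distK i φ ψ) (.necK i h)

theorem ProvM.boxc_mono (i c : ℕ) {φ ψ : FormM} (h : ProvM (.imp φ ψ)) :
    ProvM (.imp (.boxc i c φ) (.boxc i c ψ)) :=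
  .mp (.distKv i c φ ψ) (.necK i h)

theorem ProvM.dia_mono (i : ℕ) {φ ψ : FormM} (h : ProvM (.imp φ ψ)) :
    ProvM (.imp (.dia i φ) (.dia i ψ)) :=
  (h.neg_imp_neg.box_mono i).neg_imp_neg

/-- The dual form of `ProvM.kvOr`. -/
theorem ProvM.boxc_and (i c : ℕ) (φ ψ : FormM) :
    ProvM (.imp
      (.and (.and (.boxc i c φ) (.boxc i c ψ)) (.dia i (.and (.neg φ) (.neg ψ))))
      (.boxc i c (.and φ ψ))) := by
  have h₁ : ProvM (.imp (.boxc i c φ) (.boxc i c (.neg (.neg φ)))) :=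
    .boxc_mono i c <| .taut <| .imp_of_valuation fun v _ hn _ => by simp [hn]
  have h₂ : ProvM (.imp (.boxc i c ψ) (.boxc i c (.neg (.neg ψ)))) :=
    .boxc_mono i c <| .taut <| .imp_of_valuation fun v _ hn _ => by simp [hn]
  have h₃ : ProvM (.imp (.boxc i c (.neg (.or (.neg φ) (.neg ψ)))) (.boxc i c (.and φ ψ))) :=
    .boxc_mono i c <| .taut <| .imp_of_valuation fun v _ hn ha => by
      simp [FormM.or, hn, ha]
  refine .mp (.mp (.mp (.mp (.taut ?_) h₁) h₂) h₃) (.kvOr i c (.neg φ) (.neg ψ))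
  intro v ht hn ha
  simp only [FormM.imp, FormM.diac, FormM.or, hn, ha]
  grind

theorem ProvM.conjM_neg_imp_neg_conjM {L : List FormM} (hL : L ≠ []) :
    ProvM (.imp (conjM (L.map FormM.neg)) (.neg (conjM L))) := by
  obtain ⟨φ, L, rfl⟩ := List.exists_cons_of_ne_nil hL
  refine .taut <| .imp_of_valuation fun v _ hn ha => ?_
  simp only [conjM, List.map_cons, List.foldr_cons, hn, ha]
  grind

/-- for any finitely many formulas ψ₁, …, ψₙ,
`□_i^c ψ₁ ∧ ⋯ ∧ □_i^c ψₙ ∧ ◇_i(¬ψ₁ ∧ ⋯ ∧ ¬ψₙ) → □_i^c(ψ₁ ∧ ⋯ ∧ ψₙ)`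
is a theorem of SMLKV^r. -/
theorem stmt4 (i c : ℕ) (L : List FormM) :
    ProvM (.imp
      (.and (conjM (L.map (FormM.boxc i c))) (.dia i (conjM (L.map FormM.neg))))
      (.boxc i c (conjM L))) := by
  induction L with
  | nil =>
    have h : ProvM (.boxc i c .top) := .necKv i c (.taut fun _ ht _ _ => ht)
    refine .mp (.taut ?_) h
    exact .imp_of_valuation fun v _ hn ha h => by
      simp only [conjM, List.foldr_nil, FormM.imp, hn, ha, h]
      grind
  | cons φ L ih =>
    rcases eq_or_ne L [] with rfl | hL
    · refine (ProvM.and_left _ _).imp_trans ((ProvM.and_left _ _).imp_trans ?_)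
      exact .boxc_mono i c <| .taut <| .imp_of_valuation fun v ht _ ha h => by
        simp [conjM, ha, ht, h]
    · simp only [conjM, List.map_cons, List.foldr_cons] at ih ⊢
      have hbox := ProvM.and_left (.and (.boxc i c φ) (conjM (L.map (FormM.boxc i c))))
        (.dia i (.and (.neg φ) (conjM (L.map FormM.neg))))
      have hdia := ProvM.and_right (.and (.boxc i c φ) (conjM (L.map (FormM.boxc i c))))
        (.dia i (.and (.neg φ) (conjM (L.map FormM.neg))))
      have htail := ((hbox.imp_trans (.and_right _ _)).imp_and
        (hdia.imp_trans (.dia_mono i (.and_right _ _)))).imp_trans ih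
      have hneg := hdia.imp_trans (.dia_mono i ((ProvM.and_left _ _).imp_and
        ((ProvM.and_right _ _).imp_trans (.conjM_neg_imp_neg_conjM hL))))
      exact (((hbox.imp_trans (.and_left _ _)).imp_and htail).imp_and hneg).imp_trans
        (.boxc_and i c φ _)
end

section
/- On every pointed MLKv^r model M,s and for all LKv^b formulas φ, ψ: M,s ⊩ ◇_i^c(φ,ψ) if and only if M,s satisfies the disjunction of the following three formulas: (i) ◇_i^c(φ,φ) ∧ ◇_i ψ; (ii) ◇_i^c(ψ,ψ) ∧ ◇_i φ; (iii) ◇_i φ ∧ ◇_i ψ ∧ ¬◇_i^c(φ,φ) ∧ ¬◇_i^c(ψ,ψ) ∧ ◇_i^c(φ∨ψ, φ∨ψ). -/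
/-- The language LKv^b with the binary modality `boxc i c φ ψ` (□_i^c(φ,ψ)). -/
inductive FormB : Type
  | top : FormB
  | atom : ℕ → FormB
  | neg : FormB → FormB
  | and : FormB → FormB → FormB
  | box : ℕ → FormB → FormB
  | boxc : ℕ → ℕ → FormB → FormB → FormB

namespace FormB
def imp (φ ψ : FormB) : FormB := neg (and φ (neg ψ))
def or (φ ψ : FormB) : FormB := neg (and (neg φ) (neg ψ))
def iff (φ ψ : FormB) : FormB := and (imp φ ψ) (imp ψ φ)
def bot : FormB := neg top
def dia (i : ℕ) (φ : FormB) : FormB := neg (box i (neg φ))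
/-- ◇_i^c(φ,ψ) abbreviates ¬□_i^c(¬φ,¬ψ). -/
def diac (i c : ℕ) (φ ψ : FormB) : FormB := neg (boxc i c (neg φ) (neg ψ))
end FormB

/-- Satisfaction for LKv^b formulas over frames with ternary relations;
`s ⊩ ◇_i^c(φ,ψ)` iff there are `t,u` with `relc i c s t u`, `t ⊩ φ` and `u ⊩ ψ`. -/
def satB (M : KFrame) : M.S → FormB → Prop
  | _, FormB.top => True
  | s, FormB.atom p => M.val s p
  | s, FormB.neg φ => ¬ satB M s φ
  | s, FormB.and φ ψ => satB M s φ ∧ satB M s ψ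
  | s, FormB.box i φ => ∀ t, M.rel i s t → satB M t φ
  | s, FormB.boxc i c φ ψ => ∀ t u, M.relc i c s t u → satB M t φ ∨ satB M u ψ

theorem satB_or (M : KFrame) (s : M.S) (φ ψ : FormB) :
    satB M s (.or φ ψ) ↔ satB M s φ ∨ satB M s ψ := by
  simp only [FormB.or, satB]
  tauto

theorem satB_dia (M : KFrame) (s : M.S) (i : ℕ) (φ : FormB) :
    satB M s (.dia i φ) ↔ ∃ t, M.rel i s t ∧ satB M t φ := by
  simp [FormB.dia, satB]

theorem satB_diac (M : KFrame) (s : M.S) (i c : ℕ) (φ ψ : FormB) :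
    satB M s (.diac i c φ ψ) ↔ ∃ t u, M.relc i c s t u ∧ satB M t φ ∧ satB M u ψ := by
  simp [FormB.diac, satB]

/-- on every pointed MLKv^r model, ◇_i^c(φ,ψ) is equivalent to the
disjunction of (i) ◇_i^c(φ,φ) ∧ ◇_i ψ, (ii) ◇_i^c(ψ,ψ) ∧ ◇_i φ, and
(iii) ◇_i φ ∧ ◇_i ψ ∧ ¬◇_i^c(φ,φ) ∧ ¬◇_i^c(ψ,ψ) ∧ ◇_i^c(φ∨ψ,φ∨ψ). -/
theorem stmt9 (M : KFrame) (hM : M.IsMLKv) (s : M.S) (i c : ℕ) (φ ψ : FormB) :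
    satB M s (.diac i c φ ψ) ↔
    satB M s (.or (.and (.diac i c φ φ) (.dia i ψ))
      (.or (.and (.diac i c ψ ψ) (.dia i φ))
        (.and (.dia i φ) (.and (.dia i ψ)
          (.and (.neg (.diac i c φ φ)) (.and (.neg (.diac i c ψ ψ))
            (.diac i c (.or φ ψ) (.or φ ψ)))))))) := by
  obtain ⟨hsymm, hincl, hateuc⟩ := hM
  simp only [satB_or, satB, satB_dia, satB_diac]
  constructor
  · rintro ⟨t, u, h, ht, hu⟩
    obtain ⟨hst, hsu⟩ := hincl _ _ _ _ _ h
    by_cases hφ : ∃ t u, M.relc i c s t u ∧ satB M t φ ∧ satB M u φ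
    · exact Or.inl ⟨hφ, u, hsu, hu⟩
    by_cases hψ : ∃ t u, M.relc i c s t u ∧ satB M t ψ ∧ satB M u ψ
    · exact Or.inr (Or.inl ⟨hψ, t, hst, ht⟩)
    exact Or.inr (Or.inr ⟨⟨t, hst, ht⟩, ⟨u, hsu, hu⟩, hφ, hψ, t, u, h, Or.inl ht, Or.inr hu⟩)
  · rintro (⟨⟨t, u, h, ht, hu⟩, v, hsv, hv⟩ | ⟨⟨t, u, h, ht, hu⟩, v, hsv, hv⟩ |
      ⟨-, -, hφ, hψ, t, u, h, ht | ht, hu | hu⟩)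
    · rcases hateuc _ _ _ _ _ _ h hsv with h' | h'
      · exact ⟨t, v, h', ht, hv⟩
      · exact ⟨u, v, h', hu, hv⟩
    · rcases hateuc _ _ _ _ _ _ h hsv with h' | h'
      · exact ⟨v, t, (hsymm _ _ _ _ _).1 h', hv, ht⟩
      · exact ⟨v, u, (hsymm _ _ _ _ _).1 h', hv, hu⟩
    · exact absurd ⟨t, u, h, ht, hu⟩ hφ
    · exact ⟨t, u, h, ht, hu⟩
    · exact ⟨u, t, (hsymm _ _ _ _ _).1 h, hu, ht⟩
    · exact absurd ⟨t, u, h, ht, hu⟩ hψ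
end

section
/- Reduction theorem: for every LKv^b formula φ there exists an MLKv^r formula ψ (in which ◇_i^c occurs only in the unary pattern ◇_i^c χ, i.e., ◇_i^c(χ,χ)) such that for every pointed MLKv^r model M,s: M,s ⊩ φ iff M,s ⊩ ψ. Hence LKv^b and MLKv^r are equally expressive over MLKv^r models. -/
/-- `φ` belongs to the unary fragment MLKv^r of LKv^b: the two arguments of every
`boxc` coincide. -/
def FormB.IsUnary : FormB → Prop
  | .top => True
  | .atom _ => True
  | .neg φ => FormB.IsUnary φ
  | .and φ ψ => FormB.IsUnary φ ∧ FormB.IsUnary ψ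
  | .box _ φ => FormB.IsUnary φ
  | .boxc _ _ φ ψ => φ = ψ ∧ FormB.IsUnary φ

/-- `□_i^c(φ,ψ)` amounts to `□_i φ ∨ □_i ψ ∨ □_i^c(φ ∧ ψ, φ ∧ ψ)` over MLKv^r models. -/
theorem satB_boxc_iff {M : KFrame} (hM : M.IsMLKv) (s : M.S) (i c : ℕ) (φ ψ : FormB) :
    satB M s (.boxc i c φ ψ) ↔
      satB M s (.box i φ) ∨ satB M s (.box i ψ) ∨
        satB M s (.boxc i c (.and φ ψ) (.and φ ψ)) := by
  obtain ⟨hsym, hincl, hateuc⟩ := hM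
  simp only [satB]
  constructor
  · intro h
    by_contra! hcon
    obtain ⟨⟨a, ha, haφ⟩, ⟨b, hb, hbψ⟩, t, u, htu, ht, hu⟩ := hcon
    have h₁ := hateuc i c s t u a htu ha
    have h₂ := hateuc i c s t u b htu hb
    grind
  · rintro (h | h | h) t u htu
    · exact .inl (h t (hincl i c s t u htu).1)
    · exact .inr (h u (hincl i c s t u htu).2)
    · exact (h t u htu).imp And.left And.right

/-- The translation of LKv^b into its unary fragment. -/
def FormB.toUnary : FormB → FormB
  | .top => .top
  | .atom p => .atom p
  | .neg φ => .neg φ.toUnary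
  | .and φ ψ => .and φ.toUnary ψ.toUnary
  | .box i φ => .box i φ.toUnary
  | .boxc i c φ ψ =>
    .or (.box i φ.toUnary) (.or (.box i ψ.toUnary)
      (.boxc i c (.and φ.toUnary ψ.toUnary) (.and φ.toUnary ψ.toUnary)))

theorem FormB.isUnary_toUnary (φ : FormB) : φ.toUnary.IsUnary := by
  induction φ <;> simp_all [FormB.toUnary, FormB.IsUnary, FormB.or]

theorem satB_toUnary {M : KFrame} (hM : M.IsMLKv) (φ : FormB) (s : M.S) :
    satB M s φ.toUnary ↔ satB M s φ := by
  induction φ generalizing s with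
  | boxc i c φ ψ hφ hψ =>
    rw [satB_boxc_iff hM]
    simp only [FormB.toUnary, satB_or, satB, hφ, hψ]
  | _ => simp_all [FormB.toUnary, satB]


/-- reduction theorem: every LKv^b formula is equivalent, over all
MLKv^r models, to a formula of the unary fragment MLKv^r; hence the two languages are
equally expressive over MLKv^r models. -/
theorem stmt10 :
    ∀ φ : FormB, ∃ ψ : FormB, FormB.IsUnary ψ ∧
      ∀ M : KFrame, M.IsMLKv → ∀ s : M.S, (satB M s φ ↔ satB M s ψ) :=
  fun φ => ⟨φ.toUnary, φ.isUnary_toUnary, fun _ hM s => (satB_toUnary hM φ s).symm⟩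
end

section
/- The formula □_i^c(p,r) ∧ □_i^c(q,r) ∧ ◇_i ¬r → □_i^c(p,q) is a theorem of SMLKV^b. -/
/-- Uniform substitution of `χ` for the atom `p` in LKv^b formulas. -/
def FormB.subst (p : ℕ) (χ : FormB) : FormB → FormB
  | .top => .top
  | .atom q => if q = p then χ else .atom q
  | .neg φ => .neg (FormB.subst p χ φ)
  | .and φ ψ => .and (FormB.subst p χ φ) (FormB.subst p χ ψ)
  | .box i φ => .box i (FormB.subst p χ φ)
  | .boxc i c φ ψ => .boxc i c (FormB.subst p χ φ) (FormB.subst p χ ψ)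

/-- `ReplB ψ χ φ φ'`: `φ'` is obtained from `φ` by replacing some occurrences of `ψ` by `χ`. -/
inductive ReplB (ψ χ : FormB) : FormB → FormB → Prop
  | base : ReplB ψ χ ψ χ
  | refl (φ : FormB) : ReplB ψ χ φ φ
  | neg {φ φ'} : ReplB ψ χ φ φ' → ReplB ψ χ (.neg φ) (.neg φ')
  | and {φ₁ φ₁' φ₂ φ₂'} : ReplB ψ χ φ₁ φ₁' → ReplB ψ χ φ₂ φ₂' →
      ReplB ψ χ (.and φ₁ φ₂) (.and φ₁' φ₂')
  | box (i) {φ φ'} : ReplB ψ χ φ φ' → ReplB ψ χ (.box i φ) (.box i φ')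
  | boxc (i c) {φ₁ φ₁' φ₂ φ₂'} : ReplB ψ χ φ₁ φ₁' → ReplB ψ χ φ₂ φ₂' →
      ReplB ψ χ (.boxc i c φ₁ φ₂) (.boxc i c φ₁' φ₂')

/-- `φ` is an instance of a propositional tautology. -/
def TautB (φ : FormB) : Prop :=
  ∀ v : FormB → Bool, v .top = true → (∀ ψ, v (.neg ψ) = !v ψ) →
    (∀ ψ χ, v (.and ψ χ) = (v ψ && v χ)) → v φ = true

/-- The proof system SMLKV^b: TAUT, DISTK, DISTKv^b, SYM, INCL, ATEUC, with rules MP,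
necessitation for □_i, necessitation for □_i^c (from φ infer □_i^c(φ,ψ)),
uniform substitution, and replacement of equivalents. -/
inductive ProvB : FormB → Prop
  | taut {φ} : TautB φ → ProvB φ
  | distK (i : ℕ) (φ ψ : FormB) :
      ProvB (.imp (.box i (.imp φ ψ)) (.imp (.box i φ) (.box i ψ)))
  | distKvb (i c : ℕ) (φ ψ χ : FormB) :
      ProvB (.imp (.boxc i c (.imp φ ψ) χ) (.imp (.boxc i c φ χ) (.boxc i c ψ χ)))
  | symm (i c : ℕ) (φ ψ : FormB) : ProvB (.imp (.boxc i c φ ψ) (.boxc i c ψ φ))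
  | incl (i c : ℕ) (φ ψ : FormB) : ProvB (.imp (.diac i c φ ψ) (.dia i φ))
  | ateuc (i c : ℕ) (φ ψ χ : FormB) :
      ProvB (.imp (.and (.diac i c φ ψ) (.dia i χ))
        (.or (.diac i c φ χ) (.diac i c ψ χ)))
  | mp {φ ψ} : ProvB (.imp φ ψ) → ProvB φ → ProvB ψ
  | necK (i : ℕ) {φ} : ProvB φ → ProvB (.box i φ)
  | necKvb (i c : ℕ) (ψ : FormB) {φ} : ProvB φ → ProvB (.boxc i c φ ψ)
  | subst (p : ℕ) (χ : FormB) {φ} : ProvB φ → ProvB (FormB.subst p χ φ)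
  | re {ψ χ φ φ'} : ProvB (.iff ψ χ) → ReplB ψ χ φ φ' → ProvB (.iff φ φ')

/-- A formula and its double negation are provably equivalent. -/
theorem ProvB.iff_neg_neg (φ : FormB) : ProvB (.iff φ (.neg (.neg φ))) :=
  .taut fun v _ hn ha => by
    simp [FormB.iff, FormB.imp, hn, ha]

theorem ProvB.iff_trans {φ ψ χ : FormB} (h₁ : ProvB (.iff φ ψ)) (h₂ : ProvB (.iff ψ χ)) :
    ProvB (.iff φ χ) := by
  refine .mp (.mp (.taut (φ := .imp (.iff φ ψ) (.imp (.iff ψ χ) (.iff φ χ))) ?_) h₁) h₂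
  intro v _ hn ha
  simp only [FormB.iff, FormB.imp, hn, ha]
  cases v φ <;> cases v ψ <;> cases v χ <;> rfl

/-- Double negations may be introduced in both arguments of `boxc`. -/
theorem ProvB.boxc_iff_neg_neg (i c : ℕ) (φ ψ : FormB) :
    ProvB (.iff (.boxc i c φ ψ) (.boxc i c (.neg (.neg φ)) (.neg (.neg ψ)))) :=
  .iff_trans (.re (iff_neg_neg φ) (.boxc i c .base (.refl ψ)))
    (.re (iff_neg_neg ψ) (.boxc i c (.refl _) .base))

/-- □_i^c(p,r) ∧ □_i^c(q,r) ∧ ◇_i ¬r → □_i^c(p,q) is a theorem of SMLKV^b. -/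
theorem stmt13 (i c : ℕ) (φ ψ χ : FormB) :
    ProvB (.imp (.and (.boxc i c φ χ) (.and (.boxc i c ψ χ) (.dia i (.neg χ))))
      (.boxc i c φ ψ)) := by
  refine .mp (.mp (.mp (.mp (.taut ?_) (.boxc_iff_neg_neg i c φ ψ))
    (.boxc_iff_neg_neg i c φ χ)) (.boxc_iff_neg_neg i c ψ χ))
    (.ateuc i c (.neg φ) (.neg ψ) (.neg χ))
  intro v _ hn ha
  simp only [FormB.iff, FormB.imp, FormB.or, FormB.dia, FormB.diac, hn, ha]
  generalize v (.boxc i c φ ψ) = a, v (.boxc i c φ χ) = b, v (.boxc i c ψ χ) = d,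
    v (.boxc i c (.neg (.neg φ)) (.neg (.neg ψ))) = a',
    v (.boxc i c (.neg (.neg φ)) (.neg (.neg χ))) = b',
    v (.boxc i c (.neg (.neg ψ)) (.neg (.neg χ))) = d', v (.box i _) = e
  revert a b d a' b' d' e
  decide
end

section
/- Viewing the unary ◇_i^c φ as ◇_i^c(φ,φ) (and □_i^c φ as □_i^c(φ,φ)), all axioms of SMLKV^r are theorems of SMLKV^b and all rules of SMLKV^r are admissible in SMLKV^b; in particular, the formulas □_i(p→q)→(□_i^c(p,p)→□_i^c(q,q)) and ◇_i(p∧q)∧◇_i^c(p∨q,p∨q)→(◇_i^c(p,p)∨◇_i^c(q,q)) are theorems of SMLKV^b. -/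
/-- The embedding of the unary language MLKv^r into LKv^b, reading the unary □_i^c φ as
the binary □_i^c(φ,φ). -/
def embedMB : FormM → FormB
  | .top => .top
  | .atom p => .atom p
  | .neg φ => .neg (embedMB φ)
  | .and φ ψ => .and (embedMB φ) (embedMB ψ)
  | .box i φ => .box i (embedMB φ)
  | .boxc i c φ => .boxc i c (embedMB φ) (embedMB φ)

namespace ProvB

/-- The conditional is truth-functional under valuations respecting `¬` and `∧`. -/
theorem val_imp {v : FormB → Bool} (hn : ∀ ψ, v (.neg ψ) = !v ψ)
    (ha : ∀ ψ χ, v (.and ψ χ) = (v ψ && v χ)) (φ ψ : FormB) :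
    v (.imp φ ψ) = (!v φ || v ψ) := by
  simp [FormB.imp, hn, ha]

theorem val_or {v : FormB → Bool} (hn : ∀ ψ, v (.neg ψ) = !v ψ)
    (ha : ∀ ψ χ, v (.and ψ χ) = (v ψ && v χ)) (φ ψ : FormB) :
    v (.or φ ψ) = (v φ || v ψ) := by
  simp [FormB.or, hn, ha]

theorem imp_trans {φ ψ χ : FormB} (h₁ : ProvB (.imp φ ψ)) (h₂ : ProvB (.imp ψ χ)) :
    ProvB (.imp φ χ) := by
  refine mp (mp (taut ?_) h₁) h₂
  intro v _ hn ha
  simp only [val_imp hn ha]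
  grind

theorem contrapose {φ ψ : FormB} (h : ProvB (.imp (.neg φ) (.neg ψ))) :
    ProvB (.imp ψ φ) := by
  refine mp (taut ?_) h
  intro v _ hn ha
  simp only [val_imp hn ha, hn]
  grind

theorem neg_neg_elim (φ : FormB) : ProvB (.imp (.neg (.neg φ)) φ) := by
  refine taut ?_
  intro v _ hn ha
  simp [val_imp hn ha, hn]

theorem neg_neg_intro (φ : FormB) : ProvB (.imp φ (.neg (.neg φ))) := by
  refine taut ?_
  intro v _ hn ha
  simp [val_imp hn ha, hn]

theorem box_mono (i : ℕ) {φ ψ : FormB} (h : ProvB (.imp φ ψ)) :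
    ProvB (.imp (.box i φ) (.box i ψ)) :=
  mp (distK i φ ψ) (necK i h)

theorem boxc_mono_left (i c : ℕ) {φ ψ : FormB} (χ : FormB) (h : ProvB (.imp φ ψ)) :
    ProvB (.imp (.boxc i c φ χ) (.boxc i c ψ χ)) :=
  mp (distKvb i c φ ψ χ) (necKvb i c χ h)

theorem boxc_mono_right (i c : ℕ) {φ ψ : FormB} (χ : FormB) (h : ProvB (.imp φ ψ)) :
    ProvB (.imp (.boxc i c χ φ) (.boxc i c χ ψ)) :=
  imp_trans (symm i c χ φ) (imp_trans (boxc_mono_left i c χ h) (symm i c ψ χ))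

/-- The dual form of the axiom INCL: `□_i θ → □_i^c(θ, χ)`. -/
theorem boxc_of_box (i c : ℕ) (θ χ : FormB) : ProvB (.imp (.box i θ) (.boxc i c θ χ)) :=
  imp_trans (box_mono i (neg_neg_intro θ)) <|
    imp_trans (contrapose (incl i c (.neg θ) (.neg χ))) <|
      imp_trans (boxc_mono_left i c _ (neg_neg_elim θ)) (boxc_mono_right i c θ (neg_neg_elim χ))

theorem boxc_imp_of_box_imp (i c : ℕ) (φ ψ χ : FormB) :
    ProvB (.imp (.box i (.imp φ ψ)) (.imp (.boxc i c φ χ) (.boxc i c ψ χ))) :=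
  imp_trans (boxc_of_box i c (.imp φ ψ) χ) (distKvb i c φ ψ χ)

/-- The axiom DISTKv^r, with the unary `□_i^c φ` read as `□_i^c(φ, φ)`. -/
theorem distKv_diag (i c : ℕ) (φ ψ : FormB) :
    ProvB (.imp (.box i (.imp φ ψ)) (.imp (.boxc i c φ φ) (.boxc i c ψ ψ))) := by
  refine mp (mp (mp (taut ?_) (boxc_imp_of_box_imp i c φ ψ φ)) (symm i c ψ φ))
    (boxc_imp_of_box_imp i c φ ψ ψ)
  intro v _ hn ha
  simp only [val_imp hn ha]
  grind

theorem boxc_neg_or (i c : ℕ) (φ ψ χ : FormB) :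
    ProvB (.imp (.boxc i c (.neg φ) χ)
      (.imp (.boxc i c (.neg ψ) χ) (.boxc i c (.neg (.or φ ψ)) χ))) := by
  refine imp_trans (boxc_mono_left i c χ (taut ?_)) (distKvb i c (.neg ψ) (.neg (.or φ ψ)) χ)
  intro v _ hn ha
  simp only [val_imp hn ha, val_or hn ha, hn]
  grind

/-- The axiom Kv^r∨, with the unary `◇_i^c φ` read as `◇_i^c(φ, φ)`. -/
theorem kvOr_diag (i c : ℕ) (φ ψ : FormB) :
    ProvB (.imp (.and (.dia i (.and φ ψ)) (.diac i c (.or φ ψ) (.or φ ψ)))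
      (.or (.diac i c φ φ) (.diac i c ψ ψ))) := by
  have neg_and_left : ProvB (.imp (.neg φ) (.neg (.and φ ψ))) := by
    refine taut ?_
    intro v _ hn ha
    simp only [val_imp hn ha, hn, ha]
    grind
  have neg_and_right : ProvB (.imp (.neg ψ) (.neg (.and φ ψ))) := by
    refine taut ?_
    intro v _ hn ha
    simp only [val_imp hn ha, hn, ha]
    grind
  refine mp (mp (mp (mp (taut ?_) (ateuc i c (.or φ ψ) (.or φ ψ) (.and φ ψ)))
    (boxc_neg_or i c φ ψ (.neg (.and φ ψ))))
    (boxc_mono_right i c (.neg φ) neg_and_left)) (boxc_mono_right i c (.neg ψ) neg_and_right)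
  intro v _ hn ha
  simp only [FormB.diac, val_imp hn ha, val_or hn ha, hn, ha]
  grind

end ProvB

theorem embedMB_subst (p : ℕ) (χ φ : FormM) :
    embedMB (FormM.subst p χ φ) = FormB.subst p (embedMB χ) (embedMB φ) := by
  induction φ with
  | atom q =>
    simp only [FormM.subst, embedMB, FormB.subst]
    split <;> rfl
  | _ => simp_all [FormM.subst, embedMB, FormB.subst]

theorem ReplM.embed {ψ χ φ φ' : FormM} (h : ReplM ψ χ φ φ') :
    ReplB (embedMB ψ) (embedMB χ) (embedMB φ) (embedMB φ') := by
  induction h with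
  | base => exact .base
  | refl φ => exact .refl _
  | neg _ ih => exact .neg ih
  | and _ _ ih₁ ih₂ => exact .and ih₁ ih₂
  | box i _ ih => exact .box i ih
  | boxc i c _ ih => exact .boxc i c ih ih

theorem TautM.embed {φ : FormM} (h : TautM φ) : TautB (embedMB φ) := fun v ht hn ha =>
  h (fun ψ => v (embedMB ψ)) ht (fun ψ => hn (embedMB ψ))
    (fun ψ χ => ha (embedMB ψ) (embedMB χ))

theorem ProvM.embed {φ : FormM} (h : ProvM φ) : ProvB (embedMB φ) := by
  induction h with
  | taut h => exact .taut h.embed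
  | distK i φ ψ => exact .distK i (embedMB φ) (embedMB ψ)
  | distKv i c φ ψ => exact .distKv_diag i c (embedMB φ) (embedMB ψ)
  | kvOr i c φ ψ => exact .kvOr_diag i c (embedMB φ) (embedMB ψ)
  | mp _ _ ih₁ ih₂ => exact .mp ih₁ ih₂
  | necK i _ ih => exact .necK i ih
  | necKv i c _ ih => exact .necKvb i c _ ih
  | subst p χ _ ih => exact embedMB_subst p χ _ ▸ .subst p (embedMB χ) ih
  | re _ hr ih => exact .re ih hr.embed

/-- every theorem of SMLKV^r (axioms and rules included) is, under the
embedding, a theorem of SMLKV^b; in particular □_i(p→q)→(□_i^c(p,p)→□_i^c(q,q)) and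
◇_i(p∧q)∧◇_i^c(p∨q,p∨q)→(◇_i^c(p,p)∨◇_i^c(q,q)) are theorems of SMLKV^b. -/
theorem stmt14 :
    (∀ φ : FormM, ProvM φ → ProvB (embedMB φ)) ∧
    (∀ (i c : ℕ) (φ ψ : FormB),
      ProvB (.imp (.box i (.imp φ ψ)) (.imp (.boxc i c φ φ) (.boxc i c ψ ψ)))) ∧
    (∀ (i c : ℕ) (φ ψ : FormB),
      ProvB (.imp (.and (.dia i (.and φ ψ)) (.diac i c (.or φ ψ) (.or φ ψ)))
        (.or (.diac i c φ φ) (.diac i c ψ ψ)))) :=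
  ⟨fun _ h => h.embed, ProvB.distKv_diag, ProvB.kvOr_diag⟩
end

section
/- The system SMLKV^b is sound and strongly complete with respect to the class of all MLKv^r models: for any set Σ ∪ {φ} of LKv^b formulas, φ is derivable from Σ in SMLKV^b if and only if Σ semantically entails φ over MLKv^r models; in particular, every SMLKV^b-consistent set of LKv^b formulas is satisfiable at some state of some MLKv^r model. -/
/-- Conjunction of a finite list of LKv^b formulas. -/
def conjB (L : List FormB) : FormB := L.foldr FormB.and FormB.top

/-- `φ` is derivable from `Γ` in SMLKV^b. -/
def ProvFromB (Γ : Set FormB) (φ : FormB) : Prop :=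
  ∃ L : List FormB, (∀ ψ ∈ L, ψ ∈ Γ) ∧ ProvB (.imp (conjB L) φ)

/-- `Γ` is SMLKV^b-consistent. -/
def ConsistentB (Γ : Set FormB) : Prop := ¬ ProvFromB Γ .bot

/-- Semantic entailment over MLKv^r models for LKv^b formulas. -/
def EntailsB (Γ : Set FormB) (φ : FormB) : Prop :=
  ∀ M : KFrame, M.IsMLKv → ∀ s : M.S, (∀ ψ ∈ Γ, satB M s ψ) → satB M s φ

/-! ### Soundness -/

namespace KFrame

/-- The frame `M` with the valuation of `p` replaced by the truth set of `χ`. -/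
def substVal (M : KFrame) (p : ℕ) (χ : FormB) : KFrame where
  S := M.S
  rel := M.rel
  relc := M.relc
  val s q := if q = p then satB M s χ else M.val s q

theorem satB_substVal (M : KFrame) (p : ℕ) (χ φ : FormB) (s : M.S) :
    satB (M.substVal p χ) s φ ↔ satB M s (FormB.subst p χ φ) := by
  induction φ generalizing s with
  | top => simp [satB, FormB.subst]
  | atom q =>
    by_cases h : q = p <;> simp [satB, FormB.subst, substVal, h]
  | neg φ ih => exact not_congr (ih s)
  | and φ ψ ihφ ihψ => exact and_congr (ihφ s) (ihψ s)
  | box i φ ih => exact forall_congr' fun t => imp_congr Iff.rfl (ih t)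
  | boxc i c φ ψ ihφ ihψ =>
    exact forall_congr' fun t => forall_congr' fun u =>
      imp_congr Iff.rfl (or_congr (ihφ t) (ihψ u))

end KFrame

theorem satB_imp {M : KFrame} {s : M.S} {φ ψ : FormB} :
    satB M s (.imp φ ψ) ↔ (satB M s φ → satB M s ψ) := by
  simp [FormB.imp, satB]

theorem satB_iff {M : KFrame} {s : M.S} {φ ψ : FormB} :
    satB M s (.iff φ ψ) ↔ (satB M s φ ↔ satB M s ψ) := by
  rw [FormB.iff, satB, satB_imp, satB_imp, ← iff_def]

theorem satB_conjB {M : KFrame} {s : M.S} {L : List FormB} :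
    satB M s (conjB L) ↔ ∀ ψ ∈ L, satB M s ψ := by
  induction L with
  | nil => simp [conjB, satB]
  | cons a L ih => simpa [conjB, satB] using fun _ => ih

theorem ReplB.satB_congr {M : KFrame} {ψ χ φ φ' : FormB}
    (h : ∀ s : M.S, satB M s ψ ↔ satB M s χ) (hr : ReplB ψ χ φ φ') (s : M.S) :
    satB M s φ ↔ satB M s φ' := by
  induction hr generalizing s with
  | base => exact h s
  | refl => exact Iff.rfl
  | neg _ ih => exact not_congr (ih s)
  | and _ _ ih₁ ih₂ => exact and_congr (ih₁ s) (ih₂ s)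
  | box i _ ih => exact forall_congr' fun t => imp_congr Iff.rfl (ih t)
  | boxc i c _ _ ih₁ ih₂ =>
    exact forall_congr' fun t => forall_congr' fun u =>
      imp_congr Iff.rfl (or_congr (ih₁ t) (ih₂ u))

open Classical in
theorem TautB.sound {φ : FormB} (h : TautB φ) (M : KFrame) (s : M.S) : satB M s φ := by
  refine of_decide_eq_true (h (fun ψ => decide (satB M s ψ)) (decide_eq_true trivial) ?_ ?_)
  all_goals
    intros
    rw [Bool.eq_iff_iff]
    simp only [Bool.not_eq_true', decide_eq_true_iff, decide_eq_false_iff_not, Bool.and_eq_true]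
    rfl

theorem ProvB.sound {φ : FormB} (h : ProvB φ) (M : KFrame) (hM : M.IsMLKv) (s : M.S) :
    satB M s φ := by
  induction h generalizing M s with
  | taut h => exact h.sound M s
  | distK i φ ψ =>
    simp only [satB_imp, satB]
    exact fun h₁ h₂ t ht => h₁ t ht (h₂ t ht)
  | distKvb i c φ ψ χ =>
    simp only [satB_imp, satB]
    intro h₁ h₂ t u h
    have := h₁ t u h
    have := h₂ t u h
    tauto
  | symm i c φ ψ =>
    simp only [satB_imp, satB]
    exact fun h t u htu => (h u t ((hM.1 ..).1 htu)).symm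
  | incl i c φ ψ =>
    simp only [satB_imp, satB, FormB.diac, FormB.dia]
    exact fun h₁ h₂ => h₁ fun t u htu => Or.inl (h₂ t (hM.2.1 _ _ _ _ _ htu).1)
  | ateuc i c φ ψ χ =>
    simp only [satB_imp, satB, FormB.diac, FormB.dia, FormB.or]
    rintro ⟨h₁, h₂⟩ ⟨h₃, h₄⟩
    rw [not_not] at h₃ h₄
    refine h₁ fun t u htu => ?_
    by_contra! h
    refine h₂ fun v hv hχ => ?_
    rcases hM.2.2 _ _ _ _ _ _ htu hv with h' | h'
    · exact (h₃ t v h').elim (· h.1) (· hχ)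
    · exact (h₄ u v h').elim (· h.2) (· hχ)
  | mp _ _ ih₁ ih₂ => exact satB_imp.1 (ih₁ M hM s) (ih₂ M hM s)
  | necK i _ ih => exact fun t _ => ih M hM t
  | necKvb i c ψ _ ih => exact fun t _ _ => Or.inl (ih M hM t)
  | subst p χ _ ih => exact (M.satB_substVal p χ _ s).1 (ih (M.substVal p χ) hM s)
  | re _ hr ih => exact satB_iff.2 (hr.satB_congr (fun t => satB_iff.1 (ih M hM t)) s)

theorem ProvFromB.sound {Γ : Set FormB} {φ : FormB} : ProvFromB Γ φ → EntailsB Γ φ := by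
  rintro ⟨L, hL, h⟩ M hM s hs
  exact satB_imp.1 (h.sound M hM s) (satB_conjB.2 fun ψ hψ => hs ψ (hL ψ hψ))

/-! ### Propositional reasoning -/

/-- Boolean valuations of formulas respecting the propositional connectives. -/
structure IsValB (v : FormB → Bool) : Prop where
  top : v .top = true
  neg : ∀ ψ, v (.neg ψ) = !v ψ
  and : ∀ ψ χ, v (.and ψ χ) = (v ψ && v χ)

namespace IsValB

theorem imp_iff {v : FormB → Bool} (hv : IsValB v) (φ ψ : FormB) :
    v (.imp φ ψ) = true ↔ (v φ = true → v ψ = true) := by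
  simp only [FormB.imp, hv.neg, hv.and]
  cases v φ <;> cases v ψ <;> simp

theorem bot_eq {v : FormB → Bool} (hv : IsValB v) : v .bot = false := by
  simp [FormB.bot, hv.neg, hv.top]

theorem conjB_iff {v : FormB → Bool} (hv : IsValB v) (L : List FormB) :
    v (conjB L) = true ↔ ∀ ψ ∈ L, v ψ = true := by
  induction L with
  | nil => simp [conjB, hv.top]
  | cons a L ih => simpa [conjB, hv.and] using fun _ => ih

end IsValB

theorem ProvB.of_forall_val {φ : FormB} (h : ∀ v, IsValB v → v φ = true) : ProvB φ :=
  .taut fun v h₁ h₂ h₃ => h v ⟨h₁, h₂, h₃⟩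

theorem ProvB.of_val {φ ψ : FormB} (hφ : ProvB φ)
    (h : ∀ v, IsValB v → v φ = true → v ψ = true) : ProvB ψ :=
  .mp (.of_forall_val fun v hv => (hv.imp_iff _ _).2 (h v hv)) hφ

theorem ProvB.of_val₂ {φ ψ χ : FormB} (hφ : ProvB φ) (hψ : ProvB ψ)
    (h : ∀ v, IsValB v → v φ = true → v ψ = true → v χ = true) : ProvB χ :=
  .mp (hφ.of_val fun v hv hvφ => (hv.imp_iff _ _).2 (h v hv hvφ)) hψ

theorem ProvFromB.of_val₂ {Γ : Set FormB} {φ ψ χ : FormB} (hφ : ProvFromB Γ φ)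
    (hψ : ProvFromB Γ ψ) (h : ∀ v, IsValB v → v φ = true → v ψ = true → v χ = true) :
    ProvFromB Γ χ := by
  obtain ⟨L₁, hL₁, h₁⟩ := hφ
  obtain ⟨L₂, hL₂, h₂⟩ := hψ
  refine ⟨L₁ ++ L₂, fun ψ hψ => (List.mem_append.1 hψ).elim (hL₁ ψ) (hL₂ ψ), ?_⟩
  refine h₁.of_val₂ h₂ fun v hv hv₁ hv₂ => ?_
  rw [hv.imp_iff, hv.conjB_iff] at *
  exact fun hL => h v hv (hv₁ fun ψ hψ => hL ψ (List.mem_append_left _ hψ))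
    (hv₂ fun ψ hψ => hL ψ (List.mem_append_right _ hψ))

theorem ProvFromB.of_mem {Γ : Set FormB} {φ : FormB} (h : φ ∈ Γ) : ProvFromB Γ φ :=
  ⟨[φ], by simpa using h, .of_forall_val fun v hv => by simp [hv.imp_iff, hv.conjB_iff]⟩

theorem ProvFromB.of_provB {Γ : Set FormB} {φ : FormB} (h : ProvB φ) : ProvFromB Γ φ :=
  ⟨[], by simp, h.of_val fun v hv h' => (hv.imp_iff _ _).2 fun _ => h'⟩

theorem ProvFromB.provB {φ : FormB} (h : ProvFromB ∅ φ) : ProvB φ := by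
  obtain ⟨L, hL, h⟩ := h
  obtain rfl : L = [] := List.eq_nil_iff_forall_not_mem.2 hL
  exact h.of_val fun v hv h' => (hv.imp_iff _ _).1 h' hv.top

open Classical in
theorem ProvFromB.deduction {Γ : Set FormB} {φ ψ : FormB} (h : ProvFromB (insert φ Γ) ψ) :
    ProvFromB Γ (.imp φ ψ) := by
  obtain ⟨L, hL, h⟩ := h
  refine ⟨L.filter (· ≠ φ), fun χ hχ => ?_, h.of_val fun v hv hv' => ?_⟩
  · simp only [List.mem_filter, decide_eq_true_eq] at hχ
    exact (hL χ hχ.1).resolve_left hχ.2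
  · rw [hv.imp_iff, hv.conjB_iff] at hv'
    rw [hv.imp_iff, hv.imp_iff, hv.conjB_iff]
    refine fun hL' hφ => hv' fun χ hχ => ?_
    by_cases e : χ = φ
    · exact e ▸ hφ
    · exact hL' χ (by simp [hχ, e])

/-! ### Maximal consistent sets -/

/-- Consistent sets that decide every formula. -/
structure IsMCSB (s : Set FormB) : Prop where
  consistent : ConsistentB s
  mem_or_neg_mem : ∀ φ, φ ∈ s ∨ FormB.neg φ ∈ s

theorem ConsistentB.exists_isMCSB {Γ : Set FormB} (h : ConsistentB Γ) :
    ∃ s, Γ ⊆ s ∧ IsMCSB s := by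
  obtain ⟨m, hΓm, hm⟩ := zorn_subset_nonempty {Δ | ConsistentB Δ} (fun c hc hchain hne => by
    refine ⟨⋃₀ c, ?_, fun s hs => Set.subset_sUnion_of_mem hs⟩
    rintro ⟨L, hL, hbot⟩
    have : ∃ Δ ∈ c, ∀ ψ ∈ L, ψ ∈ Δ := by
      clear hbot
      induction L with
      | nil => exact hne.imp fun Δ hΔ => ⟨hΔ, by simp⟩
      | cons a L ih =>
        obtain ⟨Δ, hΔ, hLΔ⟩ := ih fun ψ hψ => hL ψ (List.mem_cons_of_mem _ hψ)
        obtain ⟨Δ', hΔ', haΔ'⟩ := hL a List.mem_cons_self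
        rcases hchain.total hΔ hΔ' with h | h
        · exact ⟨Δ', hΔ', List.forall_mem_cons.2 ⟨haΔ', fun ψ hψ => h (hLΔ ψ hψ)⟩⟩
        · exact ⟨Δ, hΔ, List.forall_mem_cons.2 ⟨h haΔ', hLΔ⟩⟩
    obtain ⟨Δ, hΔ, hLΔ⟩ := this
    exact hc hΔ ⟨L, hLΔ, hbot⟩) Γ h
  refine ⟨m, hΓm, hm.prop, fun φ => ?_⟩
  have key : ∀ ψ, ψ ∉ m → ProvFromB m (.imp ψ .bot) := fun ψ hψ => by
    refine ProvFromB.deduction (not_not.1 fun hcon => hψ ?_)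
    exact hm.le_of_ge (show insert ψ m ∈ {Δ | ConsistentB Δ} from hcon)
      (Set.subset_insert ψ m) (Set.mem_insert ψ m)
  by_contra! hφ
  refine hm.prop ((key _ hφ.1).of_val₂ (key _ hφ.2) fun v hv h₁ h₂ => ?_)
  rw [hv.imp_iff] at h₁ h₂
  rw [hv.neg] at h₂
  cases h : v φ <;> simp_all

theorem exists_isMCSB_of_not_provFromB {Γ : Set FormB} {φ : FormB} (h : ¬ ProvFromB Γ φ) :
    ∃ s, Γ ⊆ s ∧ IsMCSB s ∧ φ ∉ s := by
  have hcon : ConsistentB (insert (.neg φ) Γ) := fun hbot => h <| by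
    refine hbot.deduction.of_val₂ hbot.deduction fun v hv hv' _ => ?_
    rw [hv.imp_iff, hv.neg, hv.bot_eq] at hv'
    simpa using hv'
  obtain ⟨s, hs, hmcs⟩ := hcon.exists_isMCSB
  refine ⟨s, (Set.subset_insert _ _).trans hs, hmcs, fun hφ => hmcs.consistent ?_⟩
  refine (ProvFromB.of_mem hφ).of_val₂ (.of_mem (hs (Set.mem_insert _ _))) fun v hv h₁ h₂ => ?_
  simp [hv.neg, h₁] at h₂

namespace IsMCSB

variable {s : Set FormB} {φ ψ : FormB}

theorem mem_of_provFromB (hs : IsMCSB s) (h : ProvFromB s φ) : φ ∈ s := by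
  refine (hs.mem_or_neg_mem φ).resolve_right fun hn => hs.consistent ?_
  refine h.of_val₂ (.of_mem hn) fun v hv h₁ h₂ => ?_
  simp [hv.neg, h₁] at h₂

theorem mem_of_provB (hs : IsMCSB s) (h : ProvB φ) : φ ∈ s :=
  hs.mem_of_provFromB (.of_provB h)

theorem neg_mem (hs : IsMCSB s) : .neg φ ∈ s ↔ φ ∉ s := by
  refine ⟨fun hn h => hs.consistent ?_, (hs.mem_or_neg_mem φ).resolve_left⟩
  refine (ProvFromB.of_mem h).of_val₂ (.of_mem hn) fun v hv h₁ h₂ => ?_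
  simp [hv.neg, h₁] at h₂

theorem and_mem (hs : IsMCSB s) : .and φ ψ ∈ s ↔ φ ∈ s ∧ ψ ∈ s := by
  refine ⟨fun h => ⟨?_, ?_⟩, fun h => ?_⟩ <;> apply hs.mem_of_provFromB
  · exact (ProvFromB.of_mem h).of_val₂ (.of_mem h) fun v hv h₁ _ => by simp_all [hv.and]
  · exact (ProvFromB.of_mem h).of_val₂ (.of_mem h) fun v hv h₁ _ => by simp_all [hv.and]
  · exact (ProvFromB.of_mem h.1).of_val₂ (.of_mem h.2) fun v hv h₁ h₂ => by simp_all [hv.and]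

theorem imp_mem (hs : IsMCSB s) : .imp φ ψ ∈ s ↔ (φ ∈ s → ψ ∈ s) := by
  simp [FormB.imp, hs.neg_mem, hs.and_mem]

theorem or_mem (hs : IsMCSB s) : .or φ ψ ∈ s ↔ φ ∈ s ∨ ψ ∈ s := by
  simp only [FormB.or, hs.neg_mem, hs.and_mem]
  tauto

theorem top_mem (hs : IsMCSB s) : .top ∈ s :=
  hs.mem_of_provB (.of_forall_val fun _ hv => hv.top)

theorem bot_notMem (hs : IsMCSB s) : .bot ∉ s :=
  fun h => hs.consistent (.of_mem h)

end IsMCSB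

theorem ProvB.of_forall_isMCSB {φ : FormB} (h : ∀ s, IsMCSB s → φ ∈ s) : ProvB φ := by
  refine ProvFromB.provB (not_not.1 fun hφ => ?_)
  obtain ⟨s, -, hs, hφs⟩ := exists_isMCSB_of_not_provFromB hφ
  exact hφs (h s hs)

theorem ProvB.imp_of_forall_isMCSB {φ ψ : FormB} (h : ∀ s, IsMCSB s → φ ∈ s → ψ ∈ s) :
    ProvB (.imp φ ψ) :=
  .of_forall_isMCSB fun s hs => hs.imp_mem.2 (h s hs)

/-- A set of formulas containing all theorems and closed under modus ponens is closed under
derivability. -/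
theorem ProvFromB.mem_of_closed {f : Set FormB} (hthm : ∀ {χ}, ProvB χ → χ ∈ f)
    (hmp : ∀ {χ χ'}, .imp χ χ' ∈ f → χ ∈ f → χ' ∈ f) {φ : FormB} (h : ProvFromB f φ) :
    φ ∈ f := by
  obtain ⟨L, hL, h⟩ := h
  induction L generalizing φ with
  | nil => exact hthm (h.of_val fun v hv hv' => (hv.imp_iff _ _).1 hv' hv.top)
  | cons a L ih =>
    refine hmp (ih (fun ψ hψ => hL ψ (List.mem_cons_of_mem _ hψ)) ?_) (hL a List.mem_cons_self)
    refine h.of_val fun v hv hv' => ?_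
    simp only [hv.imp_iff, hv.conjB_iff, List.forall_mem_cons] at hv' ⊢
    exact fun h₁ h₂ => hv' ⟨h₂, h₁⟩

namespace IsMCSB

variable {s : Set FormB} {φ φ' ψ ψ' : FormB} {i c : ℕ}

theorem mem_of_imp (hs : IsMCSB s) (h : ProvB (.imp φ ψ)) (hφ : φ ∈ s) : ψ ∈ s :=
  hs.imp_mem.1 (hs.mem_of_provB h) hφ

theorem box_mp (hs : IsMCSB s) (h : .box i (.imp φ ψ) ∈ s) (hφ : .box i φ ∈ s) :
    .box i ψ ∈ s :=
  hs.imp_mem.1 (hs.mem_of_imp (.distK i φ ψ) h) hφ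

theorem boxc_mp (hs : IsMCSB s) (h : .boxc i c (.imp φ φ') ψ ∈ s) (hφ : .boxc i c φ ψ ∈ s) :
    .boxc i c φ' ψ ∈ s :=
  hs.imp_mem.1 (hs.mem_of_imp (.distKvb i c φ φ' ψ) h) hφ

theorem boxc_comm (hs : IsMCSB s) (h : .boxc i c φ ψ ∈ s) : .boxc i c ψ φ ∈ s :=
  hs.mem_of_imp (.symm i c φ ψ) h

theorem box_mono (hs : IsMCSB s) (h : ProvB (.imp φ ψ)) (hφ : .box i φ ∈ s) : .box i ψ ∈ s :=
  hs.box_mp (hs.mem_of_provB (.necK i h)) hφ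

theorem boxc_mono_left (hs : IsMCSB s) (h : ProvB (.imp φ φ')) (hφ : .boxc i c φ ψ ∈ s) :
    .boxc i c φ' ψ ∈ s :=
  hs.boxc_mp (hs.mem_of_provB (.necKvb i c ψ h)) hφ

theorem boxc_mono (hs : IsMCSB s) (h : ProvB (.imp φ φ')) (h' : ProvB (.imp ψ ψ'))
    (hφ : .boxc i c φ ψ ∈ s) : .boxc i c φ' ψ' ∈ s :=
  hs.boxc_comm (hs.boxc_mono_left h' (hs.boxc_comm (hs.boxc_mono_left h hφ)))

theorem boxc_of_box (hs : IsMCSB s) (h : .box i φ ∈ s) : .boxc i c φ ψ ∈ s := by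
  have dni (χ) : ProvB (.imp χ (.neg (.neg χ))) :=
    .imp_of_forall_isMCSB fun _ ht => by simp [ht.neg_mem]
  have dne (χ) : ProvB (.imp (.neg (.neg χ)) χ) :=
    .imp_of_forall_isMCSB fun _ ht => by simp [ht.neg_mem]
  refine hs.boxc_mono (dne φ) (dne ψ) (by_contra fun hn => ?_)
  have hdia := hs.mem_of_imp (.incl i c (.neg φ) (.neg ψ)) (hs.neg_mem.2 hn)
  exact hs.neg_mem.1 hdia (hs.box_mono (dni φ) h)

end IsMCSB

/-! ### The canonical model -/

/-- The canonical model, whose states are the maximal consistent sets. -/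
def canonicalB : KFrame where
  S := {s : Set FormB // IsMCSB s}
  rel i s t := ∀ φ, .box i φ ∈ s.1 → φ ∈ t.1
  relc i c s t u := ∀ φ ψ, .boxc i c φ ψ ∈ s.1 → φ ∈ t.1 ∨ ψ ∈ u.1
  val s p := .atom p ∈ s.1

theorem canonicalB_isMLKv : canonicalB.IsMLKv := by
  have symm : ∀ i c s t u, canonicalB.relc i c s t u → canonicalB.relc i c s u t :=
    fun i c s t u h φ ψ hφ => (h ψ φ (s.2.boxc_comm hφ)).symm
  have incl : ∀ i c s t u, canonicalB.relc i c s t u → canonicalB.rel i s t :=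
    fun i c s t u h φ hφ => (h φ .bot (s.2.boxc_of_box hφ)).resolve_right u.2.bot_notMem
  refine ⟨fun i c s t u => ⟨symm i c s t u, symm i c s u t⟩,
    fun i c s t u h => ⟨incl i c s t u h, incl i c s u t (symm i c s t u h)⟩, ?_⟩
  intro i c s t u v hR hv
  by_contra! hn
  obtain ⟨h₁, h₂⟩ := hn
  simp only [canonicalB, not_forall, not_or, exists_prop] at h₁ h₂
  obtain ⟨p₁, q₁, hpq₁, hp₁, hq₁⟩ := h₁
  obtain ⟨p₂, q₂, hpq₂, hp₂, hq₂⟩ := h₂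
  have hdiac : .diac i c (.neg p₁) (.neg p₂) ∈ s.1 := s.2.neg_mem.2 fun h => by
    have := hR _ _ h
    simp [t.2.neg_mem, u.2.neg_mem, hp₁, hp₂] at this
  have hdia : .dia i (.neg (.or q₁ q₂)) ∈ s.1 := s.2.neg_mem.2 fun h => by
    have := hv _ h
    simp [v.2.neg_mem, v.2.or_mem, hq₁, hq₂] at this
  have hdni (χ) : ProvB (.imp χ (.neg (.neg χ))) :=
    .imp_of_forall_isMCSB fun _ ht => by simp [ht.neg_mem]
  have hor := s.2.mem_of_imp (.ateuc i c _ _ _) (s.2.and_mem.2 ⟨hdiac, hdia⟩)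
  rcases s.2.or_mem.1 hor with h | h
  · refine s.2.neg_mem.1 h (s.2.boxc_mono (hdni _) (.imp_of_forall_isMCSB fun w hw hw' => ?_) hpq₁)
    simp [hw.neg_mem, hw.or_mem, hw']
  · refine s.2.neg_mem.1 h (s.2.boxc_mono (hdni _) (.imp_of_forall_isMCSB fun w hw hw' => ?_) hpq₂)
    simp [hw.neg_mem, hw.or_mem, hw']

theorem canonicalB_exists_rel {s : canonicalB.S} {i : ℕ} {φ : FormB} (h : .box i φ ∉ s.1) :
    ∃ t, canonicalB.rel i s t ∧ φ ∉ t.1 := by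
  have hn : ¬ ProvFromB {χ | .box i χ ∈ s.1} φ := fun hp =>
    h (ProvFromB.mem_of_closed (f := {χ | FormB.box i χ ∈ s.1})
      (fun hχ => s.2.mem_of_provB (.necK i hχ)) (fun h₁ => s.2.box_mp h₁) hp)
  obtain ⟨t, hst, ht, hφ⟩ := exists_isMCSB_of_not_provFromB hn
  exact ⟨⟨t, ht⟩, fun χ hχ => hst hχ, hφ⟩

theorem canonicalB_exists_relc {s : canonicalB.S} {i c : ℕ} {φ ψ : FormB}
    (h : .boxc i c φ ψ ∉ s.1) :
    ∃ t u, canonicalB.relc i c s t u ∧ φ ∉ t.1 ∧ ψ ∉ u.1 := by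
  have hφ : ¬ ProvFromB {χ | .boxc i c χ ψ ∈ s.1} φ := fun hp =>
    h (ProvFromB.mem_of_closed (f := {χ | FormB.boxc i c χ ψ ∈ s.1})
      (fun hχ => s.2.mem_of_provB (.necKvb i c ψ hχ)) (fun h₁ => s.2.boxc_mp h₁) hp)
  obtain ⟨t, hst, ht, hφt⟩ := exists_isMCSB_of_not_provFromB hφ
  have hψ : ¬ ProvFromB {χ | ∃ θ, θ ∉ t ∧ .boxc i c θ χ ∈ s.1} ψ := fun hp => by
    obtain ⟨θ, hθ, hθψ⟩ := ProvFromB.mem_of_closed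
      (f := {χ | ∃ θ, θ ∉ t ∧ .boxc i c θ χ ∈ s.1})
      (fun hχ => ⟨.bot, ht.bot_notMem, s.2.boxc_comm (s.2.mem_of_provB (.necKvb i c _ hχ))⟩)
      (by
        rintro χ χ' ⟨θ₁, hθ₁, h₁⟩ ⟨θ₂, hθ₂, h₂⟩
        refine ⟨.or θ₁ θ₂, by simp [ht.or_mem, hθ₁, hθ₂], s.2.boxc_comm (s.2.boxc_mp (φ := χ)
          (s.2.boxc_comm (s.2.boxc_mono_left ?_ h₁)) (s.2.boxc_comm (s.2.boxc_mono_left ?_ h₂)))⟩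
        · exact .imp_of_forall_isMCSB fun w hw hw' => hw.or_mem.2 (.inl hw')
        · exact .imp_of_forall_isMCSB fun w hw hw' => hw.or_mem.2 (.inr hw'))
      hp
    exact hθ (hst hθψ)
  obtain ⟨u, hsu, hu, hψu⟩ := exists_isMCSB_of_not_provFromB hψ
  refine ⟨⟨t, ht⟩, ⟨u, hu⟩, fun θ χ hθχ => ?_, hφt, hψu⟩
  exact or_iff_not_imp_left.2 fun hθ => hsu ⟨θ, hθ, hθχ⟩

theorem satB_canonicalB (φ : FormB) (s : canonicalB.S) : satB canonicalB s φ ↔ φ ∈ s.1 := by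
  induction φ generalizing s with
  | top => exact iff_of_true trivial s.2.top_mem
  | atom p => exact Iff.rfl
  | neg φ ih => exact (not_congr (ih s)).trans s.2.neg_mem.symm
  | and φ ψ ihφ ihψ => exact (and_congr (ihφ s) (ihψ s)).trans s.2.and_mem.symm
  | box i φ ih =>
    refine ⟨fun h => by_contra fun hn => ?_, fun h t ht => (ih t).2 (ht φ h)⟩
    obtain ⟨t, hst, ht⟩ := canonicalB_exists_rel hn
    exact ht ((ih t).1 (h t hst))
  | boxc i c φ ψ ihφ ihψ =>
    refine ⟨fun h => by_contra fun hn => ?_,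
      fun h t u htu => (htu φ ψ h).imp (ihφ t).2 (ihψ u).2⟩
    obtain ⟨t, u, hstu, ht, hu⟩ := canonicalB_exists_relc hn
    exact (h t u hstu).elim (fun h' => ht ((ihφ t).1 h')) fun h' => hu ((ihψ u).1 h')

/-- SMLKV^b is sound and strongly complete w.r.t. the class of all
MLKv^r models: derivability from Γ coincides with semantic entailment; in particular
every consistent set is satisfiable in an MLKv^r model. -/
theorem stmt15 :
    (∀ (Γ : Set FormB) (φ : FormB), ProvFromB Γ φ ↔ EntailsB Γ φ) ∧
    (∀ Γ : Set FormB, ConsistentB Γ →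
      ∃ M : KFrame, M.IsMLKv ∧ ∃ s : M.S, ∀ φ ∈ Γ, satB M s φ) := by
  refine ⟨fun Γ φ => ⟨ProvFromB.sound, fun h => by_contra fun hn => ?_⟩, fun Γ hΓ => ?_⟩
  · obtain ⟨s, hΓs, hs, hφ⟩ := exists_isMCSB_of_not_provFromB hn
    exact hφ ((satB_canonicalB φ ⟨s, hs⟩).1 (h canonicalB canonicalB_isMLKv ⟨s, hs⟩
      fun ψ hψ => (satB_canonicalB ψ ⟨s, hs⟩).2 (hΓs hψ)))
  · obtain ⟨s, hΓs, hs⟩ := hΓ.exists_isMCSB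
    exact ⟨canonicalB, canonicalB_isMLKv, ⟨s, hs⟩,
      fun ψ hψ => (satB_canonicalB ψ ⟨s, hs⟩).2 (hΓs hψ)⟩
end

section
/- If two pointed MLKv^r models M1,s1 and M2,s2 are C-bisimilar, then they satisfy exactly the same LKv^b formulas: for every LKv^b formula φ, M1,s1 ⊩ φ iff M2,s2 ⊩ φ. -/
/-- `Z` is a C-bisimulation between the models `M` and `N`: Inv, Zig, Zag for the binary
relations and Kvb-Zig, Kvb-Zag for the ternary relations. -/
def CBisim (M N : KFrame) (Z : M.S → N.S → Prop) : Prop :=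
  ∀ s₁ s₂, Z s₁ s₂ →
    (∀ p, M.val s₁ p ↔ N.val s₂ p) ∧
    (∀ i t₁, M.rel i s₁ t₁ → ∃ t₂, N.rel i s₂ t₂ ∧ Z t₁ t₂) ∧
    (∀ i t₂, N.rel i s₂ t₂ → ∃ t₁, M.rel i s₁ t₁ ∧ Z t₁ t₂) ∧
    (∀ i c t₁ u₁, M.relc i c s₁ t₁ u₁ →
      ∃ t₂ u₂, N.relc i c s₂ t₂ u₂ ∧ Z t₁ t₂ ∧ Z u₁ u₂) ∧
    (∀ i c t₂ u₂, N.relc i c s₂ t₂ u₂ →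
      ∃ t₁ u₁, M.relc i c s₁ t₁ u₁ ∧ Z t₁ t₂ ∧ Z u₁ u₂)

/-- Pointed models are C-bisimilar iff some C-bisimulation links the points. -/
def CBisimilar (M N : KFrame) (s : M.S) (t : N.S) : Prop :=
  ∃ Z, CBisim M N Z ∧ Z s t

/-- Points linked by a C-bisimulation satisfy the same formulas. -/
theorem CBisim.satB_iff {M N : KFrame} {Z : M.S → N.S → Prop} (hZ : CBisim M N Z)
    (φ : FormB) {s : M.S} {t : N.S} (h : Z s t) : satB M s φ ↔ satB N t φ := by
  induction φ generalizing s t with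
  | top => exact Iff.rfl
  | atom p => exact (hZ s t h).1 p
  | neg φ ih => exact not_congr (ih h)
  | and φ ψ ihφ ihψ => exact and_congr (ihφ h) (ihψ h)
  | box i φ ih =>
    obtain ⟨-, zig, zag, -, -⟩ := hZ s t h
    constructor
    · intro hs t₂ ht₂
      obtain ⟨t₁, ht₁, hz⟩ := zag i t₂ ht₂
      exact (ih hz).1 (hs t₁ ht₁)
    · intro ht t₁ ht₁
      obtain ⟨t₂, ht₂, hz⟩ := zig i t₁ ht₁
      exact (ih hz).2 (ht t₂ ht₂)
  | boxc i c φ ψ ihφ ihψ =>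
    obtain ⟨-, -, -, zig, zag⟩ := hZ s t h
    constructor
    · intro hs t₂ u₂ hr
      obtain ⟨t₁, u₁, hr', ht, hu⟩ := zag i c t₂ u₂ hr
      exact (hs t₁ u₁ hr').imp (ihφ ht).1 (ihψ hu).1
    · intro ht t₁ u₁ hr
      obtain ⟨t₂, u₂, hr', ht', hu⟩ := zig i c t₁ u₁ hr
      exact (ht t₂ u₂ hr').imp (ihφ ht').2 (ihψ hu).2

/-- C-bisimilar pointed MLKv^r models satisfy the same LKv^b formulas. -/
theorem stmt16 (M N : KFrame) (hM : M.IsMLKv) (hN : N.IsMLKv)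
    (s : M.S) (t : N.S) (h : CBisimilar M N s t) :
    ∀ φ : FormB, satB M s φ ↔ satB N t φ := by
  obtain ⟨Z, hZ, hst⟩ := h
  exact fun φ => hZ.satB_iff φ hst
end

section
/- For finite FO Kripke models M1 and M2: M1,s1 and M2,s2 are C-bisimilar (in the sense of C-bisimulation over FO Kripke models) if and only if they satisfy exactly the same ELKv^r formulas. -/
/-- `Z` is a C-bisimulation between FO Kripke models: Inv, Zig, Zag, Kvr-Zig, Kvr-Zag. -/
def CBisimFO (M N : FOModel) (Z : M.S → N.S → Prop) : Prop :=
  ∀ s₁ s₂, Z s₁ s₂ →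
    (∀ p, M.val s₁ p ↔ N.val s₂ p) ∧
    (∀ i t₁, M.rel i s₁ t₁ → ∃ t₂, N.rel i s₂ t₂ ∧ Z t₁ t₂) ∧
    (∀ i t₂, N.rel i s₂ t₂ → ∃ t₁, M.rel i s₁ t₁ ∧ Z t₁ t₂) ∧
    (∀ i c t₁ u₁, M.rel i s₁ t₁ → M.rel i s₁ u₁ → M.valC c t₁ ≠ M.valC c u₁ →
      ∃ t₂ u₂, N.rel i s₂ t₂ ∧ N.rel i s₂ u₂ ∧ Z t₁ t₂ ∧ Z u₁ u₂ ∧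
        N.valC c t₂ ≠ N.valC c u₂) ∧
    (∀ i c t₂ u₂, N.rel i s₂ t₂ → N.rel i s₂ u₂ → N.valC c t₂ ≠ N.valC c u₂ →
      ∃ t₁ u₁, M.rel i s₁ t₁ ∧ M.rel i s₁ u₁ ∧ Z t₁ t₂ ∧ Z u₁ u₂ ∧
        M.valC c t₁ ≠ M.valC c u₁)

/-- Pointed FO Kripke models are C-bisimilar iff some C-bisimulation links the points. -/
def CBisimilarFO (M N : FOModel) (s : M.S) (t : N.S) : Prop :=
  ∃ Z, CBisimFO M N Z ∧ Z s t

/-- Two pointed models satisfy the same ELKv^r formulas. -/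
def SameTheory (M N : FOModel) (s : M.S) (t : N.S) : Prop :=
  ∀ φ : FormE, satE M s φ ↔ satE N t φ

theorem SameTheory.symm {M N : FOModel} {s : M.S} {t : N.S} (h : SameTheory M N s t) :
    SameTheory N M t s :=
  fun φ => (h φ).symm

theorem CBisimFO.sameTheory {M N : FOModel} {Z : M.S → N.S → Prop} (hZ : CBisimFO M N Z)
    {s : M.S} {t : N.S} (hst : Z s t) : SameTheory M N s t := by
  intro φ
  induction φ generalizing s t with
  | top => exact Iff.rfl
  | atom p => exact (hZ s t hst).1 p
  | neg φ ih => exact not_congr (ih hst)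
  | and φ ψ ih₁ ih₂ => exact and_congr (ih₁ hst) (ih₂ hst)
  | K i φ ih =>
    obtain ⟨-, zig, zag, -, -⟩ := hZ s t hst
    constructor
    · intro h t₂ ht₂
      obtain ⟨t₁, ht₁, hz⟩ := zag i t₂ ht₂
      exact (ih hz).1 (h t₁ ht₁)
    · intro h t₁ ht₁
      obtain ⟨t₂, ht₂, hz⟩ := zig i t₁ ht₁
      exact (ih hz).2 (h t₂ ht₂)
  | Kv i φ c ih =>
    obtain ⟨-, -, -, zig, zag⟩ := hZ s t hst
    constructor
    · intro h t₂ u₂ ht₂ hu₂ hφt hφu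
      by_contra hne
      obtain ⟨t₁, u₁, ht₁, hu₁, hzt, hzu, hne'⟩ := zag i c t₂ u₂ ht₂ hu₂ hne
      exact hne' (h t₁ u₁ ht₁ hu₁ ((ih hzt).2 hφt) ((ih hzu).2 hφu))
    · intro h t₁ u₁ ht₁ hu₁ hφt hφu
      by_contra hne
      obtain ⟨t₂, u₂, ht₂, hu₂, hzt, hzu, hne'⟩ := zig i c t₁ u₁ ht₁ hu₁ hne
      exact hne' (h t₂ u₂ ht₂ hu₂ ((ih hzt).1 hφt) ((ih hzu).1 hφu))

theorem exists_satE_of_not_sameTheory {M N : FOModel} {s : M.S} {t : N.S}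
    (h : ¬ SameTheory M N s t) : ∃ φ, satE M s φ ∧ ¬ satE N t φ := by
  obtain ⟨φ, hφ⟩ := not_forall.1 h
  by_cases hs : satE M s φ
  · exact ⟨φ, hs, fun ht => hφ (iff_of_true hs ht)⟩
  · exact ⟨φ.neg, hs, fun ht => hφ (iff_of_false hs ht)⟩

/-- Over a finite model `N`, the theory of a pointed model is captured by one formula. -/
theorem exists_characteristic_formula {M : FOModel} (N : FOModel) [Finite N.S] (s : M.S) :
    ∃ χ, satE M s χ ∧ ∀ t, satE N t χ → SameTheory M N s t := by
  classical
  have := Fintype.ofFinite N.S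
  suffices h : ∀ A : Finset N.S,
      ∃ χ, satE M s χ ∧ ∀ t ∈ A, satE N t χ → SameTheory M N s t by
    obtain ⟨χ, hs, hχ⟩ := h Finset.univ
    exact ⟨χ, hs, fun t => hχ t (Finset.mem_univ t)⟩
  intro A
  induction A using Finset.induction_on with
  | empty => exact ⟨FormE.top, trivial, by simp⟩
  | insert a A _ ih =>
    obtain ⟨χ, hs, hχ⟩ := ih
    by_cases ha : SameTheory M N s a
    · refine ⟨χ, hs, fun t ht hsat => ?_⟩
      rcases Finset.mem_insert.1 ht with rfl | ht
      · exact ha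
      · exact hχ t ht hsat
    · obtain ⟨φ, hφs, hφa⟩ := exists_satE_of_not_sameTheory ha
      refine ⟨φ.and χ, ⟨hφs, hs⟩, fun t ht hsat => ?_⟩
      rcases Finset.mem_insert.1 ht with rfl | ht
      · exact absurd hsat.1 hφa
      · exact hχ t ht hsat.2

theorem SameTheory.zig {M N : FOModel} [Finite N.S] {s₁ : M.S} {s₂ : N.S}
    (h : SameTheory M N s₁ s₂) {i : ℕ} {t₁ : M.S} (ht₁ : M.rel i s₁ t₁) :
    ∃ t₂, N.rel i s₂ t₂ ∧ SameTheory M N t₁ t₂ := by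
  obtain ⟨χ, hsat, hχ⟩ := exists_characteristic_formula N t₁
  by_contra! hno
  exact (h (FormE.K i χ.neg)).2 (fun t₂ ht₂ hsat₂ => hno t₂ ht₂ (hχ t₂ hsat₂)) t₁ ht₁ hsat

theorem SameTheory.kvZig {M N : FOModel} [Finite N.S] {s₁ : M.S} {s₂ : N.S}
    (h : SameTheory M N s₁ s₂) {i c : ℕ} {t₁ u₁ : M.S} (ht₁ : M.rel i s₁ t₁)
    (hu₁ : M.rel i s₁ u₁) (hne : M.valC c t₁ ≠ M.valC c u₁) :
    ∃ t₂ u₂, N.rel i s₂ t₂ ∧ N.rel i s₂ u₂ ∧ SameTheory M N t₁ t₂ ∧ SameTheory M N u₁ u₂ ∧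
      N.valC c t₂ ≠ N.valC c u₂ := by
  obtain ⟨χ, hsatt, hχ⟩ := exists_characteristic_formula N t₁
  obtain ⟨ξ, hsatu, hξ⟩ := exists_characteristic_formula N u₁
  obtain ⟨t₂, ht₂, htt⟩ := h.zig ht₁
  obtain ⟨u₂, hu₂, huu⟩ := h.zig hu₁
  by_contra! hno
  -- `χ ∨ ξ`, written with the primitive connectives
  refine hne ((h (FormE.Kv i (χ.neg.and ξ.neg).neg c)).2 ?_ t₁ u₁ ht₁ hu₁
    (fun hn => hn.1 hsatt) (fun hn => hn.2 hsatu))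
  have key : ∀ v, N.rel i s₂ v → satE N v (χ.neg.and ξ.neg).neg →
      N.valC c v = N.valC c t₂ := by
    intro v hv hsat
    by_cases hvχ : satE N v χ
    · exact (hno v u₂ hv hu₂ (hχ v hvχ) huu).trans (hno t₂ u₂ ht₂ hu₂ htt huu).symm
    · have hvξ : satE N v ξ := by_contra fun hn => hsat ⟨hvχ, hn⟩
      exact (hno t₂ v ht₂ hv htt (hξ v hvξ)).symm
  intro v w hv hw hsv hsw
  exact (key v hv hsv).trans (key w hw hsw).symm

theorem cBisimFO_sameTheory (M N : FOModel) [Finite M.S] [Finite N.S] :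
    CBisimFO M N (SameTheory M N) := by
  intro s₁ s₂ h
  refine ⟨fun p => h (FormE.atom p), fun i t₁ => h.zig, fun i t₂ ht₂ => ?_,
    fun i c t₁ u₁ => h.kvZig, fun i c t₂ u₂ ht₂ hu₂ hne => ?_⟩
  · obtain ⟨t₁, ht₁, h'⟩ := h.symm.zig ht₂
    exact ⟨t₁, ht₁, h'.symm⟩
  · obtain ⟨t₁, u₁, ht₁, hu₁, ht, hu, hne'⟩ := h.symm.kvZig ht₂ hu₂ hne
    exact ⟨t₁, u₁, ht₁, hu₁, ht.symm, hu.symm, hne'⟩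

/-- for finite FO Kripke models, C-bisimilarity coincides with
ELKv^r-equivalence. -/
theorem stmt18 (M N : FOModel) (hMfin : Finite M.S) (hNfin : Finite N.S)
    (s : M.S) (t : N.S) :
    CBisimilarFO M N s t ↔ ∀ φ : FormE, (satE M s φ ↔ satE N t φ) := by
  exact ⟨fun ⟨_, hZ, hst⟩ => hZ.sameTheory hst,
    fun h => ⟨SameTheory M N, cBisimFO_sameTheory M N, h⟩⟩
end
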